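/- Let n ≥ 2, let f : Sⁿ → (0,∞) be a smooth function on the unit sphere Sⁿ ⊂ ℝⁿ⁺¹, and let A = {x ∈ ℝⁿ⁺¹ : x ≠ 0 and ‖x‖ ≥ f(x/‖x‖)}, with open interior A° = {x ∈ ℝⁿ⁺¹ : x ≠ 0 and ‖x‖ > f(x/‖x‖)}. Let Ω ⊂ ℝⁿ⁺¹ be a bounded open set with Ω ⊆ A and such that 0 does not belong to the closure of the convex hull of Ω. Let W : ℝⁿ⁺¹ → ℝⁿ⁺¹ be C² and let q : ℝⁿ⁺¹ → ℂ be bounded and measurable. Then there exist ε₀ > 0 and C > 0 such that for every ε ∈ (0, ε₀] there is h₀ > 0 such that for all h ∈ (0, h₀] and all w ∈ C_c^∞(Ω; ℂ): (h/√ε)·‖w‖_{L²(Ω)} ≤ C·‖L_{φ,W,q,ε} w‖_{H⁻¹_h(A°)}. -/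

import Mathlib

open MeasureTheory Complex Set

noncomputable section

/-- Euclidean space `ℝ^d`. -/
abbrev Euc (d : ℕ) := EuclideanSpace ℝ (Fin d)

/-- Partial derivative in the `j`-th coordinate direction. -/
def pd {d : ℕ} {F : Type*} [NormedAddCommGroup F] [NormedSpace ℝ F]
    (j : Fin d) (u : Euc d → F) : Euc d → F :=
  fun x => fderiv ℝ u x (EuclideanSpace.single j 1)

/-- The magnetic Schrödinger operator
`L_{W,q} u = -Δu - 2i⟨W,∇u⟩ - i (div W) u + (‖W‖² + q) u`. -/
def magSchrodinger {d : ℕ} (W : Euc d → Euc d) (q : Euc d → ℂ) (u : Euc d → ℂ) :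
    Euc d → ℂ :=
  fun x =>
    -(∑ j, pd j (pd j u) x)
    - 2 * Complex.I * ∑ j, ((W x j : ℝ) : ℂ) * pd j u x
    - Complex.I * (((∑ j, pd j (fun y => W y j) x) : ℝ) : ℂ) * u x
    + ((((‖W x‖ ^ 2 : ℝ)) : ℂ) + q x) * u x

/-- The logarithmic limiting Carleman weight `φ(x) = log ‖x‖`. -/
def carlWeight {d : ℕ} (x : Euc d) : ℝ := Real.log ‖x‖

/-- The conjugated operator `L_{φ,W,q,ε} w = h² e^{φ/h + φ²/(2ε)} L_{W,q}(e^{-φ/h - φ²/(2ε)} w)`. -/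
def conjOpEps {d : ℕ} (h ε : ℝ) (W : Euc d → Euc d) (q : Euc d → ℂ) (w : Euc d → ℂ) :
    Euc d → ℂ :=
  fun x =>
    ((h : ℂ) ^ 2) *
      Complex.exp (((carlWeight x / h + (carlWeight x) ^ 2 / (2 * ε) : ℝ) : ℂ)) *
      magSchrodinger W q
        (fun y =>
          Complex.exp (((-(carlWeight y / h + (carlWeight y) ^ 2 / (2 * ε)) : ℝ) : ℂ)) * w y) x

/-- `w ∈ C_c^∞(U; ℂ)`. -/
def IsTest {d : ℕ} (U : Set (Euc d)) (w : Euc d → ℂ) : Prop :=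
  ContDiff ℝ (⊤ : ℕ∞) w ∧ HasCompactSupport w ∧ tsupport w ⊆ U

/-- The `L²` norm on a set. -/
def L2normOn {d : ℕ} (U : Set (Euc d)) (w : Euc d → ℂ) : ℝ :=
  Real.sqrt (∫ x in U, ‖w x‖ ^ 2)

/-- The semiclassical `H¹` norm on an open set. -/
def H1norm {d : ℕ} (h : ℝ) (U : Set (Euc d)) (ψ : Euc d → ℂ) : ℝ :=
  Real.sqrt ((∫ x in U, ‖ψ x‖ ^ 2) + h ^ 2 * ∫ x in U, ∑ j, ‖pd j ψ x‖ ^ 2)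

/-- The semiclassical `H⁻¹` norm on an open set, defined by duality against
smooth compactly supported test functions. -/
def Hneg1norm {d : ℕ} (h : ℝ) (U : Set (Euc d)) (v : Euc d → ℂ) : ℝ :=
  sSup {r : ℝ | ∃ ψ : Euc d → ℂ, IsTest U ψ ∧ H1norm h U ψ ≤ 1 ∧
    r = ‖∫ x in U, v x * (starRingEnd ℂ) (ψ x)‖}

section Calculus

variable {d : ℕ}

lemma pd_mul {𝔸 : Type*} [NormedCommRing 𝔸] [NormedAlgebra ℝ 𝔸] (j : Fin d) {u v : Euc d → 𝔸}
    {x : Euc d} (hu : DifferentiableAt ℝ u x) (hv : DifferentiableAt ℝ v x) :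
    pd j (fun y => u y * v y) x = pd j u x * v x + u x * pd j v x := by
  simp only [pd]
  rw [fderiv_fun_mul hu hv]
  simp [mul_comm, add_comm]

lemma pd_add {F : Type*} [NormedAddCommGroup F] [NormedSpace ℝ F] (j : Fin d) {u v : Euc d → F}
    {x : Euc d} (hu : DifferentiableAt ℝ u x) (hv : DifferentiableAt ℝ v x) :
    pd j (fun y => u y + v y) x = pd j u x + pd j v x := by
  simp only [pd]
  rw [fderiv_fun_add hu hv]
  simp

lemma pd_sub {F : Type*} [NormedAddCommGroup F] [NormedSpace ℝ F] (j : Fin d) {u v : Euc d → F}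
    {x : Euc d} (hu : DifferentiableAt ℝ u x) (hv : DifferentiableAt ℝ v x) :
    pd j (fun y => u y - v y) x = pd j u x - pd j v x := by
  simp only [pd]
  rw [fderiv_fun_sub hu hv]
  simp

lemma pd_const {F : Type*} [NormedAddCommGroup F] [NormedSpace ℝ F] (j : Fin d) (c : F)
    (x : Euc d) : pd j (fun _ => c) x = 0 := by
  simp [pd]

lemma pd_comp_clm {F G : Type*} [NormedAddCommGroup F] [NormedSpace ℝ F]
    [NormedAddCommGroup G] [NormedSpace ℝ G] (l : F →L[ℝ] G) (j : Fin d) {u : Euc d → F}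
    {x : Euc d} (hu : DifferentiableAt ℝ u x) :
    pd j (fun y => l (u y)) x = l (pd j u x) := by
  have := (l.hasFDerivAt.comp x hu.hasFDerivAt).fderiv
  simp only [pd]
  rw [show (fun y => l (u y)) = l ∘ u from rfl, this]
  simp

lemma pd_conj (j : Fin d) {u : Euc d → ℂ} {x : Euc d} (hu : DifferentiableAt ℝ u x) :
    pd j (fun y => (starRingEnd ℂ) (u y)) x = (starRingEnd ℂ) (pd j u x) :=
  pd_comp_clm (Complex.conjCLE : ℂ →L[ℝ] ℂ) j hu

lemma pd_ofReal (j : Fin d) {g : Euc d → ℝ} {x : Euc d} (hg : DifferentiableAt ℝ g x) :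
    pd j (fun y => ((g y : ℝ) : ℂ)) x = ((pd j g x : ℝ) : ℂ) :=
  pd_comp_clm Complex.ofRealCLM j hg

lemma pd_rexp (j : Fin d) {g : Euc d → ℝ} {x : Euc d} (hg : DifferentiableAt ℝ g x) :
    pd j (fun y => Real.exp (g y)) x = Real.exp (g x) * pd j g x := by
  simp only [pd]
  rw [(hg.hasFDerivAt.exp).fderiv]
  simp

lemma pd_coord (j k : Fin d) (x : Euc d) :
    pd j (fun y => y k) x = if j = k then 1 else 0 := by
  have : HasFDerivAt (fun y : Euc d => y k) (EuclideanSpace.proj (𝕜 := ℝ) k) x :=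
    (EuclideanSpace.proj (𝕜 := ℝ) k).hasFDerivAt
  simp only [pd]
  rw [this.fderiv]
  simp [eq_comm]

lemma fderiv_apply_eq_sum {F : Type*} [NormedAddCommGroup F] [NormedSpace ℝ F]
    (u : Euc d → F) (x y : Euc d) : fderiv ℝ u x y = ∑ j, y j • pd j u x := by
  have : y = ∑ j, y j • EuclideanSpace.single j (1 : ℝ) := by
    ext i
    simp [Finset.sum_apply, Pi.single_apply]
  conv_lhs => rw [this]
  simp [pd]

lemma carlWeight_contDiffAt {x : Euc d} (hx : x ≠ 0) {k : WithTop ℕ∞} :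
    ContDiffAt ℝ k (carlWeight (d := d)) x :=
  (contDiffAt_norm ℝ hx).log (norm_ne_zero_iff.2 hx)

lemma pd_carlWeight (j : Fin d) {x : Euc d} (hx : x ≠ 0) :
    pd j carlWeight x = x j / ‖x‖ ^ 2 := by
  have h1 : (carlWeight : Euc d → ℝ) = fun y => Real.log (‖y‖ ^ 2) / 2 := by
    ext y
    simp [carlWeight, Real.log_pow]
  have hx' : ‖x‖ ^ 2 ≠ 0 := by positivity
  have h2 := (((hasStrictFDerivAt_norm_sq x).hasFDerivAt.log hx').mul_const (2⁻¹ : ℝ)).fderiv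
  rw [h1]
  simp only [pd, div_eq_mul_inv]
  rw [h2]
  simp [EuclideanSpace.inner_single_right]
  field_simp

/-- The density `‖x‖^(-d)` of the dilation invariant measure, away from the origin. -/
def dilWeight (x : Euc d) : ℝ := Real.exp (-(d * carlWeight x))

lemma dilWeight_pos (x : Euc d) : 0 < dilWeight x := Real.exp_pos _

lemma dilWeight_contDiffAt {x : Euc d} (hx : x ≠ 0) {k : WithTop ℕ∞} :
    ContDiffAt ℝ k (dilWeight (d := d)) x :=
  (contDiffAt_const.mul (carlWeight_contDiffAt hx)).neg.exp

lemma pd_dilWeight (j : Fin d) {x : Euc d} (hx : x ≠ 0) :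
    pd j dilWeight x = -(d * (x j / ‖x‖ ^ 2) * dilWeight x) := by
  have hd : DifferentiableAt ℝ (carlWeight (d := d)) x :=
    (carlWeight_contDiffAt (k := 1) hx).differentiableAt (by simp)
  have h : pd j (fun y : Euc d => -(d * carlWeight y)) x = -(d * (x j / ‖x‖ ^ 2)) := by
    have := pd_comp_clm ((-(d : ℝ)) • ContinuousLinearMap.id ℝ ℝ) j hd
    simp only [smul_apply, ContinuousLinearMap.id_apply, smul_eq_mul,
      neg_mul] at this
    rw [this, pd_carlWeight j hx]
  have := pd_rexp j (g := fun y : Euc d => -(d * carlWeight y)) (hd.const_mul _).fun_neg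
  unfold dilWeight
  rw [this, h]
  ring

lemma sum_coord_sq (x : Euc d) : ∑ j, x j ^ 2 = ‖x‖ ^ 2 := by
  rw [EuclideanSpace.real_norm_sq_eq]

lemma pd_contDiff {F : Type*} [NormedAddCommGroup F] [NormedSpace ℝ F] (j : Fin d) {u : Euc d → F}
    (hu : ContDiff ℝ (⊤ : ℕ∞) u) : ContDiff ℝ (⊤ : ℕ∞) (pd j u) :=
  (hu.fderiv_right (m := (⊤ : ℕ∞)) (by exact_mod_cast le_rfl)).clm_apply contDiff_const

lemma pd_continuousOn {F : Type*} [NormedAddCommGroup F] [NormedSpace ℝ F] (j : Fin d)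
    {u : Euc d → F} {U : Set (Euc d)} (hU : IsOpen U) (hu : ContDiffOn ℝ 1 u U) :
    ContinuousOn (pd j u) U :=
  (hu.continuousOn_fderiv_of_isOpen hU le_rfl).clm_apply continuousOn_const

lemma tsupport_pd_subset {F : Type*} [NormedAddCommGroup F] [NormedSpace ℝ F] (j : Fin d)
    (u : Euc d → F) : tsupport (pd j u) ⊆ tsupport u := by
  refine (closure_mono ?_).trans (tsupport_fderiv_subset ℝ (f := u))
  intro x hx h
  exact hx (by simp [pd, h])

lemma pd_eq_zero {F : Type*} [NormedAddCommGroup F] [NormedSpace ℝ F] (j : Fin d)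
    {u : Euc d → F} {x : Euc d} (hx : x ∉ tsupport u) : pd j u x = 0 :=
  image_eq_zero_of_notMem_tsupport fun h => hx (tsupport_pd_subset j u h)

end Calculus

section Test

variable {d : ℕ}

/-- The punctured space. -/
abbrev Punct (d : ℕ) : Set (Euc d) := {x | x ≠ 0}

lemma isOpen_punct : IsOpen (Punct d) := isOpen_ne

lemma IsTest.mono {U V : Set (Euc d)} {w : Euc d → ℂ} (hw : IsTest U w) (h : U ⊆ V) :
    IsTest V w := ⟨hw.1, hw.2.1, hw.2.2.trans h⟩

lemma IsTest.partialDeriv {U : Set (Euc d)} {w : Euc d → ℂ} (hw : IsTest U w) (j : Fin d) :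
    IsTest U (pd j w) :=
  ⟨pd_contDiff j hw.1, hw.2.1.of_isClosed_subset (isClosed_tsupport _) (tsupport_pd_subset j w),
    (tsupport_pd_subset j w).trans hw.2.2⟩

lemma IsTest.zero {U : Set (Euc d)} : IsTest U (fun _ : Euc d => (0 : ℂ)) := by
  refine ⟨contDiff_const, HasCompactSupport.zero, ?_⟩
  have : tsupport (fun _ : Euc d => (0 : ℂ)) = ∅ := by
    rw [tsupport_eq_empty_iff]; rfl
  rw [this]; exact empty_subset _

lemma IsTest.add {U : Set (Euc d)} {u v : Euc d → ℂ} (hu : IsTest U u) (hv : IsTest U v) :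
    IsTest U (fun x => u x + v x) :=
  ⟨hu.1.add hv.1, hu.2.1.add hv.2.1,
    (tsupport_add u v).trans (union_subset hu.2.2 hv.2.2)⟩

/-- A test function on a punctured domain may be multiplied by a function smooth away from `0`. -/
lemma IsTest.mul_left {U : Set (Euc d)} {u g : Euc d → ℂ} (hu : IsTest U u) (hU : U ⊆ Punct d)
    (hg : ∀ x ≠ 0, ContDiffAt ℝ (⊤ : ℕ∞) g x) : IsTest U (fun x => g x * u x) := by
  have hs : tsupport (fun x => g x * u x) ⊆ tsupport u := tsupport_mul_subset_right
  refine ⟨?_, hu.2.1.of_isClosed_subset (isClosed_tsupport _) hs, hs.trans hu.2.2⟩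
  rw [contDiff_iff_contDiffAt]
  intro x
  by_cases hx : x ∈ tsupport u
  · exact (hg x (hU (hu.2.2 hx))).mul hu.1.contDiffAt
  · have : (fun x => g x * u x) =ᶠ[nhds x] fun _ => 0 := by
      filter_upwards [notMem_tsupport_iff_eventuallyEq.1 hx] with y hy
      simp [hy]
    exact contDiffAt_const.congr_of_eventuallyEq this

lemma IsTest.smul {U : Set (Euc d)} {u : Euc d → ℂ} (hu : IsTest U u) (c : ℂ) :
    IsTest U (fun x => c * u x) :=
  have hs : tsupport (fun x => c * u x) ⊆ tsupport u := tsupport_mul_subset_right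
  ⟨contDiff_const.mul hu.1, hu.2.1.of_isClosed_subset (isClosed_tsupport _) hs, hs.trans hu.2.2⟩

lemma IsTest.sub {U : Set (Euc d)} {u v : Euc d → ℂ} (hu : IsTest U u) (hv : IsTest U v) :
    IsTest U (fun x => u x - v x) := by
  simpa [sub_eq_add_neg] using hu.add (hv.smul (-1))

lemma IsTest.differentiable {U : Set (Euc d)} {u : Euc d → ℂ} (hu : IsTest U u) :
    Differentiable ℝ u := hu.1.differentiable (by simp)

lemma IsTest.integrable {F : Type*} [NormedAddCommGroup F] {u : Euc d → ℂ}
    (hu : IsTest (Punct d) u) {g : Euc d → F}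
    (hg : ContinuousOn g (Punct d)) (h0 : ∀ x ∉ tsupport u, g x = 0) : Integrable g :=
  ((hg.mono hu.2.2).integrableOn_compact hu.2.1).integrable_of_forall_notMem_eq_zero h0

lemma IsTest.contDiff_of_contDiffOn {F : Type*} [NormedAddCommGroup F] [NormedSpace ℝ F]
    {u : Euc d → ℂ} (hu : IsTest (Punct d) u) {g : Euc d → F} {k : WithTop ℕ∞}
    (hg : ContDiffOn ℝ k g (Punct d)) (h0 : ∀ x ∉ tsupport u, g x = 0) : ContDiff ℝ k g := by
  rw [contDiff_iff_contDiffAt]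
  intro x
  by_cases hx : x ∈ tsupport u
  · exact hg.contDiffAt (isOpen_punct.mem_nhds (hu.2.2 hx))
  · have : g =ᶠ[nhds x] fun _ => 0 := by
      filter_upwards [(isClosed_tsupport u).isOpen_compl.mem_nhds hx] with y hy
      exact h0 y hy
    exact contDiffAt_const.congr_of_eventuallyEq this

lemma IsTest.integral_pd_eq_zero {u : Euc d → ℂ} (hu : IsTest (Punct d) u) {g : Euc d → ℂ}
    (hg : ContDiffOn ℝ 1 g (Punct d)) (h0 : ∀ x ∉ tsupport u, g x = 0) (j : Fin d) :
    ∫ x, pd j g x = 0 := by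
  have hg' := hu.contDiff_of_contDiffOn hg h0
  have hcs : HasCompactSupport g := HasCompactSupport.intro hu.2.1 h0
  have h1 : Integrable g := hg'.continuous.integrable_of_hasCompactSupport hcs
  have hc : Continuous (pd j g) := (hg'.continuous_fderiv (by simp)).clm_apply continuous_const
  have h2 : Integrable (pd j g) := hc.integrable_of_hasCompactSupport
    (hcs.of_isClosed_subset (isClosed_tsupport _) (tsupport_pd_subset j g))
  have := integral_mul_fderiv_eq_neg_fderiv_mul_of_integrable (μ := volume) (𝕜 := ℂ)
    (f := fun _ : Euc d => (1 : ℂ)) (g := g) (v := EuclideanSpace.single j 1)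
    (by simp) (by simp only [one_mul]; exact h2) (by simpa using h1)
    (fun x _ => differentiableAt_const _) (fun x _ => hg'.differentiable (by simp) x)
  simpa [pd] using this

end Test

section WeakForm

variable {d : ℕ}

/-- The convexified weight `φ/h + φ²/(2ε)`. -/
def convWeight (h ε : ℝ) (x : Euc d) : ℝ := carlWeight x / h + carlWeight x ^ 2 / (2 * ε)

lemma convWeight_contDiffAt (h ε : ℝ) {x : Euc d} (hx : x ≠ 0) {k : WithTop ℕ∞} :
    ContDiffAt ℝ k (convWeight (d := d) h ε) x :=
  ((carlWeight_contDiffAt hx).div_const h).add (((carlWeight_contDiffAt hx).pow 2).div_const _)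

lemma pd_convWeight (h : ℝ) {ε : ℝ} (hε : ε ≠ 0) (j : Fin d) {x : Euc d} (hx : x ≠ 0) :
    pd j (convWeight h ε) x = (1 / h + carlWeight x / ε) * (x j / ‖x‖ ^ 2) := by
  have hd : DifferentiableAt ℝ (carlWeight (d := d)) x :=
    (carlWeight_contDiffAt (k := 1) hx).differentiableAt (by simp)
  have h1 : convWeight (d := d) h ε =
      fun y => carlWeight y * (1 / h + carlWeight y * (1 / (2 * ε))) := by
    ext y
    simp only [convWeight]
    ring
  have h2 : pd j (fun y : Euc d => 1 / h + carlWeight y * (1 / (2 * ε))) x =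
      pd j carlWeight x * (1 / (2 * ε)) := by
    rw [pd_add j (differentiableAt_const _) (hd.mul_const _), pd_const,
      pd_mul j hd (differentiableAt_const _), pd_const]
    ring
  rw [h1, pd_mul j hd ((differentiableAt_const _).fun_add (hd.mul_const _)), h2, pd_carlWeight j hx]
  field_simp
  ring

/-- The integrand of the weak formulation of the conjugated operator. -/
def weakIntegrand (h ε : ℝ) (W : Euc d → Euc d) (q : Euc d → ℂ) (w ψ : Euc d → ℂ) (x : Euc d) :
    ℂ :=
  (h : ℂ) ^ 2 * ∑ j, (pd j w x - (pd j (convWeight h ε) x : ℝ) * w x) *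
      ((starRingEnd ℂ) (pd j ψ x) + (pd j (convWeight h ε) x : ℝ) * (starRingEnd ℂ) (ψ x)) +
    (h : ℂ) ^ 2 * w x *
      (Complex.I * ((∑ j, pd j (fun y => W y j) x : ℝ) : ℂ) * (starRingEnd ℂ) (ψ x) +
        2 * Complex.I * ∑ j, ((W x j : ℝ) : ℂ) * (starRingEnd ℂ) (pd j ψ x) +
        2 * Complex.I * (∑ j, ((W x j : ℝ) : ℂ) * (pd j (convWeight h ε) x : ℝ)) *
          (starRingEnd ℂ) (ψ x) +
        (((‖W x‖ ^ 2 : ℝ) : ℂ) + q x) * (starRingEnd ℂ) (ψ x))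

/-- The conjugated function `e^{-φ/h - φ²/(2ε)} w`. -/
def conjFun (h ε : ℝ) (w : Euc d → ℂ) (y : Euc d) : ℂ :=
  ((Real.exp (-convWeight h ε y) : ℝ) : ℂ) * w y

lemma IsTest.conjFun {U : Set (Euc d)} {w : Euc d → ℂ} (hw : IsTest U w) (hU : U ⊆ Punct d)
    (h ε : ℝ) : IsTest U (conjFun h ε w) :=
  hw.mul_left hU fun _ hx => Complex.ofRealCLM.contDiff.contDiffAt.comp _
    (convWeight_contDiffAt h ε hx).neg.exp

lemma conjOpEps_eq (h ε : ℝ) (W : Euc d → Euc d) (q : Euc d → ℂ) (w : Euc d → ℂ) (x : Euc d) :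
    conjOpEps h ε W q w x = (h : ℂ) ^ 2 * ((Real.exp (convWeight h ε x) : ℝ) : ℂ) *
      magSchrodinger W q (conjFun h ε w) x := by
  have h1 : conjFun h ε w = fun y =>
      Complex.exp (((-(carlWeight y / h + carlWeight y ^ 2 / (2 * ε)) : ℝ) : ℂ)) * w y := by
    ext y
    simp only [conjFun, convWeight, Complex.ofReal_exp]
  rw [h1]
  simp only [conjOpEps, convWeight, Complex.ofReal_exp]

lemma pd_conjFun (h ε : ℝ) {w : Euc d → ℂ} (hw : Differentiable ℝ w) {x : Euc d} (hx : x ≠ 0)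
    (j : Fin d) : pd j (conjFun h ε w) x = ((Real.exp (-convWeight h ε x) : ℝ) : ℂ) *
      (pd j w x - (pd j (convWeight h ε) x : ℝ) * w x) := by
  have hd : DifferentiableAt ℝ (convWeight (d := d) h ε) x :=
    (convWeight_contDiffAt (k := 1) h ε hx).differentiableAt (by simp)
  have h1 : pd j (fun y : Euc d => Real.exp (-convWeight h ε y)) x =
      -(Real.exp (-convWeight h ε x) * pd j (convWeight h ε) x) := by
    rw [pd_rexp j (g := fun y : Euc d => -convWeight h ε y) hd.fun_neg]
    have := pd_comp_clm (-ContinuousLinearMap.id ℝ ℝ) j hd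
    simp only [neg_apply, ContinuousLinearMap.id_apply] at this
    rw [this]
    ring
  have h2 : DifferentiableAt ℝ (fun y : Euc d => Real.exp (-convWeight h ε y)) x := hd.fun_neg.exp
  have h3 : DifferentiableAt ℝ (fun y : Euc d => ((Real.exp (-convWeight h ε y) : ℝ) : ℂ)) x :=
    Complex.ofRealCLM.differentiableAt.comp x h2
  unfold conjFun
  rw [pd_mul j h3 (hw x), pd_ofReal j h2, h1]
  push_cast
  ring

/-- The vector field whose divergence relates the strong and the weak formulation. -/
def weakField (h ε : ℝ) (W : Euc d → Euc d) (w ψ : Euc d → ℂ) (j : Fin d) (x : Euc d) : ℂ :=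
  -((h : ℂ) ^ 2 * (pd j (conjFun h ε w) x *
      (((Real.exp (convWeight h ε x) : ℝ) : ℂ) * (starRingEnd ℂ) (ψ x)))) -
    2 * Complex.I * (h : ℂ) ^ 2 * (((W x j : ℝ) : ℂ) * (w x * (starRingEnd ℂ) (ψ x)))

lemma differentiableAt_conj {u : Euc d → ℂ} {x : Euc d} (hu : DifferentiableAt ℝ u x) :
    DifferentiableAt ℝ (fun y => (starRingEnd ℂ) (u y)) x :=
  (Complex.conjCLE : ℂ →L[ℝ] ℂ).differentiableAt.comp x hu

lemma differentiableAt_ofReal {u : Euc d → ℝ} {x : Euc d} (hu : DifferentiableAt ℝ u x) :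
    DifferentiableAt ℝ (fun y => ((u y : ℝ) : ℂ)) x :=
  Complex.ofRealCLM.differentiableAt.comp x hu

lemma pd_const_mul (c : ℂ) (j : Fin d) {u : Euc d → ℂ} {x : Euc d}
    (hu : DifferentiableAt ℝ u x) : pd j (fun y => c * u y) x = c * pd j u x := by
  rw [pd_mul j (differentiableAt_const _) hu, pd_const]
  ring

lemma pd_neg' (j : Fin d) {u : Euc d → ℂ} {x : Euc d}
    (hu : DifferentiableAt ℝ u x) : pd j (fun y => -u y) x = -pd j u x := by
  simpa using pd_const_mul (-1) j hu

lemma pd_weakField (h ε : ℝ) {W : Euc d → Euc d} (hW : Differentiable ℝ W) {w ψ : Euc d → ℂ}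
    (hw : IsTest (Punct d) w) (hψ : IsTest (Punct d) ψ) {x : Euc d} (hx : x ≠ 0) (j : Fin d) :
    pd j (weakField h ε W w ψ j) x =
      -((h : ℂ) ^ 2 * (pd j (pd j (conjFun h ε w)) x *
        (((Real.exp (convWeight h ε x) : ℝ) : ℂ) * (starRingEnd ℂ) (ψ x)) +
        (pd j w x - (pd j (convWeight h ε) x : ℝ) * w x) *
        ((starRingEnd ℂ) (pd j ψ x) + (pd j (convWeight h ε) x : ℝ) * (starRingEnd ℂ) (ψ x)))) -
      2 * Complex.I * (h : ℂ) ^ 2 * ((pd j (fun y => W y j) x : ℝ) * (w x * (starRingEnd ℂ) (ψ x)) +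
        ((W x j : ℝ) : ℂ) * (pd j w x * (starRingEnd ℂ) (ψ x) +
          w x * (starRingEnd ℂ) (pd j ψ x))) := by
  have hd : DifferentiableAt ℝ (convWeight (d := d) h ε) x :=
    (convWeight_contDiffAt (k := 1) h ε hx).differentiableAt (by simp)
  have hψd := hψ.differentiable x
  have hwd := hw.differentiable x
  have hcu := ((hw.conjFun subset_rfl h ε).partialDeriv j).differentiable x
  have hWj : DifferentiableAt ℝ (fun y => W y j) x :=
    (EuclideanSpace.proj (𝕜 := ℝ) j).differentiableAt.comp x (hW x)
  have he : DifferentiableAt ℝ (fun y : Euc d => Real.exp (convWeight h ε y)) x := hd.exp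
  have h2 := (differentiableAt_ofReal he).fun_mul (differentiableAt_conj hψd)
  have h3 := hwd.fun_mul (differentiableAt_conj hψd)
  have h4 := (differentiableAt_ofReal hWj).fun_mul h3
  unfold weakField
  rw [pd_sub j ((hcu.fun_mul h2).const_mul _).fun_neg (h4.const_mul _),
    pd_neg' j ((hcu.fun_mul h2).const_mul _), pd_const_mul _ j (hcu.fun_mul h2),
    pd_const_mul _ j h4, pd_mul j hcu h2, pd_mul j (differentiableAt_ofReal hWj) h3,
    pd_mul j hwd (differentiableAt_conj hψd),
    pd_mul j (differentiableAt_ofReal he) (differentiableAt_conj hψd), pd_conj j hψd,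
    pd_ofReal j he, pd_ofReal j hWj, pd_rexp j hd, pd_conjFun h ε hw.differentiable hx j]
  have hexp : ((Real.exp (-convWeight h ε x) : ℝ) : ℂ) * ((Real.exp (convWeight h ε x) : ℝ) : ℂ)
      = 1 := by
    rw [← Complex.ofReal_mul, ← Real.exp_add]
    simp
  push_cast at hexp ⊢
  linear_combination (-(h : ℂ) ^ 2 * (pd j w x - (pd j (convWeight h ε) x : ℝ) * w x) *
    ((starRingEnd ℂ) (pd j ψ x) + (pd j (convWeight h ε) x : ℝ) * (starRingEnd ℂ) (ψ x))) * hexp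

lemma conjOpEps_mul_conj_eq (h ε : ℝ) {W : Euc d → Euc d} (hW : Differentiable ℝ W)
    (q : Euc d → ℂ) {w ψ : Euc d → ℂ}
    (hw : IsTest (Punct d) w) (hψ : IsTest (Punct d) ψ) {x : Euc d} (hx : x ≠ 0) :
    conjOpEps h ε W q w x * (starRingEnd ℂ) (ψ x) =
      ∑ j, pd j (weakField h ε W w ψ j) x + weakIntegrand h ε W q w ψ x := by
  have hexp : ((Real.exp (-convWeight h ε x) : ℝ) : ℂ) * ((Real.exp (convWeight h ε x) : ℝ) : ℂ)
      = 1 := by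
    rw [← Complex.ofReal_mul, ← Real.exp_add]
    simp
  rw [conjOpEps_eq]
  simp only [magSchrodinger, weakIntegrand, pd_weakField h ε hW hw hψ hx,
    pd_conjFun h ε hw.differentiable hx]
  rw [conjFun]
  generalize ((Real.exp (-convWeight h ε x) : ℝ) : ℂ) = e' at *
  generalize ((Real.exp (convWeight h ε x) : ℝ) : ℂ) = e at *
  generalize (starRingEnd ℂ) (ψ x) = ψc
  simp only [Complex.ofReal_sum]
  generalize ((‖W x‖ ^ 2 : ℝ) : ℂ) = nW
  generalize q x = qx
  have hsum : ∀ P X V Wc dw ψj : Fin d → ℂ, ∀ wx c k : ℂ,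
      ∑ j, (-(c * (P j * (e * ψc) + X j)) - k * (V j * (wx * ψc) +
        Wc j * (dw j * ψc + wx * ψj j))) =
      -(c * ((∑ j, P j) * (e * ψc) + ∑ j, X j)) - k * ((∑ j, V j) * (wx * ψc) +
        (∑ j, Wc j * dw j) * ψc + wx * ∑ j, Wc j * ψj j) := by
    intro P X V Wc dw ψj wx c k
    simp only [Finset.sum_mul, Finset.mul_sum, ← Finset.sum_add_distrib, ← Finset.sum_neg_distrib,
      ← Finset.sum_sub_distrib]
    exact Finset.sum_congr rfl fun j _ => by ring
  rw [hsum (fun j => pd j (pd j (conjFun h ε w)) x)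
    (fun j => (pd j w x - (pd j (convWeight h ε) x : ℝ) * w x) *
      ((starRingEnd ℂ) (pd j ψ x) + (pd j (convWeight h ε) x : ℝ) * ψc))
    (fun j => ((pd j (fun y => W y j) x : ℝ) : ℂ)) (fun j => ((W x j : ℝ) : ℂ))
    (fun j => pd j w x) (fun j => (starRingEnd ℂ) (pd j ψ x)) (w x)]
  have h1 : ∑ j, ((W x j : ℝ) : ℂ) * (e' * (pd j w x - (pd j (convWeight h ε) x : ℝ) * w x)) =
      e' * (∑ j, ((W x j : ℝ) : ℂ) * pd j w x) -
        e' * (∑ j, ((W x j : ℝ) : ℂ) * (pd j (convWeight h ε) x : ℝ)) * w x := by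
    rw [Finset.mul_sum, Finset.mul_sum, Finset.sum_mul, ← Finset.sum_sub_distrib]
    exact Finset.sum_congr rfl fun j _ => by ring
  rw [h1]
  generalize ∑ j, ((W x j : ℝ) : ℂ) * pd j w x = A
  generalize ∑ j, ((W x j : ℝ) : ℂ) * (pd j (convWeight h ε) x : ℝ) = B
  generalize ∑ j, ((pd j (fun y => W y j) x : ℝ) : ℂ) = D
  generalize w x = wx
  linear_combination ((h : ℂ) ^ 2 * ψc * (-2 * Complex.I * (A - B * wx) - Complex.I * D * wx +
    (nW + qx) * wx)) * hexp

end WeakForm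

section Integrals

variable {d : ℕ}

lemma integrable_mul_mul_conj {q : Euc d → ℂ} (hq : Measurable q) {M : ℝ} (hM : ∀ x, ‖q x‖ ≤ M)
    {w ψ : Euc d → ℂ} (hw : IsTest (Punct d) w) (hψ : IsTest (Punct d) ψ) :
    Integrable fun x => q x * (w x * (starRingEnd ℂ) (ψ x)) := by
  have h1 : Integrable fun x => w x * (starRingEnd ℂ) (ψ x) := by
    refine hw.integrable ?_ fun x hx => by simp [image_eq_zero_of_notMem_tsupport hx]
    exact (hw.1.continuous.mul (Complex.continuous_conj.comp hψ.1.continuous)).continuousOn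
  exact h1.bdd_mul hq.aestronglyMeasurable (Filter.Eventually.of_forall hM)

lemma contDiffOn_ofReal {u : Euc d → ℝ} {s : Set (Euc d)} {k : WithTop ℕ∞}
    (hu : ContDiffOn ℝ k u s) : ContDiffOn ℝ k (fun y => ((u y : ℝ) : ℂ)) s :=
  Complex.ofRealCLM.contDiff.comp_contDiffOn hu

lemma contDiff_conj {u : Euc d → ℂ} {k : WithTop ℕ∞}
    (hu : ContDiff ℝ k u) : ContDiff ℝ k (fun y => (starRingEnd ℂ) (u y)) :=
  (Complex.conjCLE : ℂ →L[ℝ] ℂ).contDiff.comp hu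

lemma convWeight_contDiffOn (h ε : ℝ) {k : WithTop ℕ∞} :
    ContDiffOn ℝ k (convWeight (d := d) h ε) (Punct d) :=
  fun _ hx => (convWeight_contDiffAt h ε hx).contDiffWithinAt

lemma dilWeight_contDiffOn {k : WithTop ℕ∞} :
    ContDiffOn ℝ k (dilWeight (d := d)) (Punct d) :=
  fun _ hx => (dilWeight_contDiffAt hx).contDiffWithinAt

lemma contDiff_coord {k : WithTop ℕ∞} {W : Euc d → Euc d} (hW : ContDiff ℝ k W) (j : Fin d) :
    ContDiff ℝ k fun y => W y j :=
  (EuclideanSpace.proj (𝕜 := ℝ) j).contDiff.comp hW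

lemma weakField_contDiffOn (h ε : ℝ) {W : Euc d → Euc d} (hW : ContDiff ℝ 2 W) {w ψ : Euc d → ℂ}
    (hw : IsTest (Punct d) w) (hψ : IsTest (Punct d) ψ) (j : Fin d) :
    ContDiffOn ℝ 1 (weakField h ε W w ψ j) (Punct d) := by
  have h1 : ContDiff ℝ 1 (pd j (conjFun h ε w)) :=
    ((hw.conjFun subset_rfl h ε).partialDeriv j).1.of_le (by exact_mod_cast le_top)
  have h2 : ContDiff ℝ 1 ψ := hψ.1.of_le (by exact_mod_cast le_top)
  have h3 : ContDiff ℝ 1 w := hw.1.of_le (by exact_mod_cast le_top)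
  have h4 := contDiffOn_ofReal (convWeight_contDiffOn (d := d) h ε (k := 1)).exp
  have h5 : ContDiff ℝ 1 fun y => ((W y j : ℝ) : ℂ) :=
    Complex.ofRealCLM.contDiff.comp ((contDiff_coord hW j).of_le (by norm_num))
  exact ((contDiffOn_const.mul (h1.contDiffOn.mul (h4.mul (contDiff_conj h2).contDiffOn))).neg).sub
    (contDiffOn_const.mul (h5.mul (h3.mul (contDiff_conj h2))).contDiffOn)

lemma weakField_eq_zero (h ε : ℝ) (W : Euc d → Euc d) {w ψ : Euc d → ℂ} (j : Fin d) {x : Euc d}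
    (hx : x ∉ tsupport ψ) : weakField h ε W w ψ j x = 0 := by
  simp [weakField, image_eq_zero_of_notMem_tsupport hx]

lemma weakIntegrand_integrable (h ε : ℝ) {W : Euc d → Euc d} (hW : ContDiff ℝ 2 W)
    {q : Euc d → ℂ} (hq : Measurable q) {M : ℝ} (hM : ∀ x, ‖q x‖ ≤ M) {w ψ : Euc d → ℂ}
    (hw : IsTest (Punct d) w) (hψ : IsTest (Punct d) ψ) :
    Integrable (weakIntegrand h ε W q w ψ) := by
  have h1 : weakIntegrand h ε W q w ψ = fun x => weakIntegrand h ε W (fun _ => 0) w ψ x +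
      (h : ℂ) ^ 2 * (q x * (w x * (starRingEnd ℂ) (ψ x))) := by
    ext x
    simp only [weakIntegrand]
    ring
  rw [h1]
  refine Integrable.add ?_ ((integrable_mul_mul_conj hq hM hw hψ).const_mul _)
  refine hw.integrable ?_ fun x hx => by
    simp [weakIntegrand, image_eq_zero_of_notMem_tsupport hx, pd_eq_zero _ hx]
  have hW' : Continuous W := hW.continuous
  have c1 : ∀ j, ContinuousOn (fun x => ((pd j (convWeight (d := d) h ε) x : ℝ) : ℂ)) (Punct d) :=
    fun j => Complex.continuous_ofReal.comp_continuousOn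
      (pd_continuousOn j isOpen_punct (convWeight_contDiffOn h ε))
  have c2 : ∀ j, ContinuousOn (pd j w) (Punct d) := fun j =>
    (hw.partialDeriv j).1.continuous.continuousOn
  have c3 : ∀ j, ContinuousOn (fun x => (starRingEnd ℂ) (pd j ψ x)) (Punct d) := fun j =>
    (Complex.continuous_conj.comp (hψ.partialDeriv j).1.continuous).continuousOn
  have c4 : ContinuousOn (fun x => (starRingEnd ℂ) (ψ x)) (Punct d) :=
    (Complex.continuous_conj.comp hψ.1.continuous).continuousOn
  have c5 : ContinuousOn w (Punct d) := hw.1.continuous.continuousOn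
  have c6 : ∀ j, ContinuousOn (fun x => ((W x j : ℝ) : ℂ)) (Punct d) := fun j =>
    (Complex.continuous_ofReal.comp (contDiff_coord hW j).continuous).continuousOn
  have c7 : ContinuousOn (fun x => ((∑ j, pd j (fun y => W y j) x : ℝ) : ℂ)) (Punct d) :=
    Complex.continuous_ofReal.comp_continuousOn (continuousOn_finsetSum _ fun j _ =>
      pd_continuousOn j isOpen_punct ((contDiff_coord hW j).of_le (by norm_num)).contDiffOn)
  have c8 : ContinuousOn (fun x => ((‖W x‖ ^ 2 : ℝ) : ℂ)) (Punct d) :=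
    (Complex.continuous_ofReal.comp (hW'.norm.pow 2)).continuousOn
  unfold weakIntegrand
  refine ContinuousOn.add (continuousOn_const.mul (continuousOn_finsetSum _ fun j _ => ?_)) ?_
  · exact ((c2 j).sub ((c1 j).mul c5)).mul ((c3 j).add ((c1 j).mul c4))
  · refine (continuousOn_const.mul c5).mul (((ContinuousOn.add ?_ ?_).add ?_).add ?_)
    · exact (continuousOn_const.mul c7).mul c4
    · exact continuousOn_const.mul (continuousOn_finsetSum _ fun j _ => (c6 j).mul (c3 j))
    · exact (continuousOn_const.mul
        (continuousOn_finsetSum _ fun j _ => (c6 j).mul (c1 j))).mul c4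
    · exact (c8.add continuousOn_const).mul c4

lemma ae_ne_zero [Nontrivial (Euc d)] : ∀ᵐ x : Euc d, x ≠ 0 :=
  compl_mem_ae_iff.2 (measure_singleton 0)

lemma integral_conjOpEps_mul_conj [Nontrivial (Euc d)] (h ε : ℝ) {W : Euc d → Euc d}
    (hW : ContDiff ℝ 2 W) {q : Euc d → ℂ} (hq : Measurable q) {M : ℝ} (hM : ∀ x, ‖q x‖ ≤ M)
    {w ψ : Euc d → ℂ} (hw : IsTest (Punct d) w) (hψ : IsTest (Punct d) ψ) :
    ∫ x, conjOpEps h ε W q w x * (starRingEnd ℂ) (ψ x) = ∫ x, weakIntegrand h ε W q w ψ x := by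
  have hF : ∀ j, ContDiffOn ℝ 1 (weakField h ε W w ψ j) (Punct d) :=
    weakField_contDiffOn h ε hW hw hψ
  have hi : ∀ j, Integrable (pd j (weakField h ε W w ψ j)) := fun j =>
    hψ.integrable (pd_continuousOn j isOpen_punct (hF j)) fun x hx => by
      have : weakField h ε W w ψ j =ᶠ[nhds x] fun _ => 0 := by
        filter_upwards [(isClosed_tsupport ψ).isOpen_compl.mem_nhds hx] with y hy
        exact weakField_eq_zero h ε W j hy
      simp [pd, this.fderiv_eq]
  rw [integral_congr_ae (g := fun x => ∑ j, pd j (weakField h ε W w ψ j) x +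
    weakIntegrand h ε W q w ψ x) (by
      filter_upwards [ae_ne_zero] with x hx
      exact conjOpEps_mul_conj_eq h ε (hW.differentiable (by simp)) q hw hψ hx),
    integral_add (integrable_finsetSum _ fun j _ => hi j)
      (weakIntegrand_integrable h ε hW hq hM hw hψ), integral_finsetSum _ fun j _ => hi j]
  simp [fun j => hψ.integral_pd_eq_zero (hF j) (fun x hx => weakField_eq_zero h ε W j hx) j]

lemma conjOpEps_eq_add (h ε : ℝ) (W : Euc d → Euc d) (q : Euc d → ℂ) (w : Euc d → ℂ) (x : Euc d) :
    conjOpEps h ε W q w x = conjOpEps h ε W (fun _ => 0) w x + (h : ℂ) ^ 2 * (q x * w x) := by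
  have hexp : ((Real.exp (-convWeight h ε x) : ℝ) : ℂ) * ((Real.exp (convWeight h ε x) : ℝ) : ℂ)
      = 1 := by
    rw [← Complex.ofReal_mul, ← Real.exp_add]
    simp
  rw [conjOpEps_eq, conjOpEps_eq]
  simp only [magSchrodinger]
  rw [show conjFun h ε w x = ((Real.exp (-convWeight h ε x) : ℝ) : ℂ) * w x from rfl]
  linear_combination ((h : ℂ) ^ 2 * q x * w x) * hexp

lemma conjOpEps_zero_continuousOn (h ε : ℝ) {W : Euc d → Euc d} (hW : ContDiff ℝ 2 W)
    {w : Euc d → ℂ} (hw : IsTest (Punct d) w) :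
    ContinuousOn (conjOpEps h ε W (fun _ => 0) w) (Punct d) := by
  have hu := hw.conjFun subset_rfl h ε
  have c6 : ∀ j, ContinuousOn (fun x => ((W x j : ℝ) : ℂ)) (Punct d) := fun j =>
    (Complex.continuous_ofReal.comp (contDiff_coord hW j).continuous).continuousOn
  have c7 : ContinuousOn (fun x => ((∑ j, pd j (fun y => W y j) x : ℝ) : ℂ)) (Punct d) :=
    Complex.continuous_ofReal.comp_continuousOn (continuousOn_finsetSum _ fun j _ =>
      pd_continuousOn j isOpen_punct ((contDiff_coord hW j).of_le (by norm_num)).contDiffOn)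
  have c8 : ContinuousOn (fun x => ((‖W x‖ ^ 2 : ℝ) : ℂ)) (Punct d) :=
    (Complex.continuous_ofReal.comp (hW.continuous.norm.pow 2)).continuousOn
  have c9 : ContinuousOn (conjFun h ε w) (Punct d) := hu.1.continuous.continuousOn
  have he : ContinuousOn (fun x => ((Real.exp (convWeight (d := d) h ε x) : ℝ) : ℂ)) (Punct d) :=
    (contDiffOn_ofReal (convWeight_contDiffOn (d := d) h ε (k := 1)).exp).continuousOn
  rw [funext (conjOpEps_eq h ε W (fun _ => 0) w)]
  refine (continuousOn_const.mul he).mul ?_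
  unfold magSchrodinger
  refine ((ContinuousOn.sub ?_ ?_).sub ?_).add ?_
  · exact (continuousOn_finsetSum _ fun j _ =>
      ((hu.partialDeriv j).partialDeriv j).1.continuous.continuousOn).neg
  · exact continuousOn_const.mul (continuousOn_finsetSum _ fun j _ =>
      (c6 j).mul (hu.partialDeriv j).1.continuous.continuousOn)
  · exact (continuousOn_const.mul c7).mul c9
  · exact (c8.add continuousOn_const).mul c9

lemma conjOpEps_zero_eq_zero (h ε : ℝ) (W : Euc d → Euc d)
    {w : Euc d → ℂ} {x : Euc d} (hx : x ∉ tsupport w) :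
    conjOpEps h ε W (fun _ => 0) w x = 0 := by
  have hx' : x ∉ tsupport (conjFun h ε w) := fun h' => hx (tsupport_mul_subset_right h')
  have h2 : ∀ j, x ∉ tsupport (pd j (conjFun h ε w)) := fun j h' =>
    hx' (tsupport_pd_subset j _ h')
  rw [conjOpEps_eq]
  simp [magSchrodinger, pd_eq_zero _ hx', image_eq_zero_of_notMem_tsupport hx',
    fun j => pd_eq_zero j (h2 j)]

lemma conjOpEps_memLp (h ε : ℝ) {W : Euc d → Euc d}
    (hW : ContDiff ℝ 2 W) {q : Euc d → ℂ} (hq : Measurable q) {M : ℝ} (hM : ∀ x, ‖q x‖ ≤ M)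
    {w : Euc d → ℂ} (hw : IsTest (Punct d) w) :
    MemLp (conjOpEps h ε W q w) 2 := by
  have hq' : MemLp (fun x => q x * w x) 2 := by
    have h1 : MemLp w 2 := hw.1.continuous.memLp_of_hasCompactSupport hw.2.1
    exact MemLp.of_le_mul (c := M) h1
      (hq.aestronglyMeasurable.mul hw.1.continuous.aestronglyMeasurable)
      (Filter.Eventually.of_forall fun x => by
        rw [norm_mul]; exact mul_le_mul_of_nonneg_right (hM x) (norm_nonneg _))
  rw [funext (conjOpEps_eq_add h ε W q w)]
  refine MemLp.add ?_ (hq'.const_mul _)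
  have hc := conjOpEps_zero_continuousOn h ε hW hw
  have h0 : ∀ x ∉ tsupport w, conjOpEps h ε W (fun _ => 0) w x = 0 :=
    fun x hx => conjOpEps_zero_eq_zero h ε W hx
  have hc' : Continuous (conjOpEps h ε W (fun _ => 0) w) :=
    contDiff_zero.1 (hw.contDiff_of_contDiffOn (k := 0) (contDiffOn_zero.2 hc) h0)
  exact hc'.memLp_of_hasCompactSupport (HasCompactSupport.intro hw.2.1 h0)

lemma H1norm_smul (h : ℝ) (U : Set (Euc d)) {ψ : Euc d → ℂ} (hψ : Differentiable ℝ ψ) {c : ℝ}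
    (hc : 0 ≤ c) : H1norm h U (fun x => (c : ℂ) * ψ x) = c * H1norm h U ψ := by
  have h1 : ∀ j x, pd j (fun x => (c : ℂ) * ψ x) x = c * pd j ψ x := fun j x =>
    pd_const_mul _ j (hψ x)
  simp only [H1norm, h1, norm_mul, Complex.norm_real, mul_pow, ← Finset.mul_sum,
    integral_const_mul, Real.norm_eq_abs, sq_abs]
  rw [← Real.sqrt_sq hc, ← Real.sqrt_mul (sq_nonneg _), Real.sqrt_sq hc]
  congr 1
  ring

lemma bddAbove_Hneg1norm (h : ℝ) (U : Set (Euc d)) {v : Euc d → ℂ} (hv : MemLp v 2) :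
    BddAbove {r : ℝ | ∃ ψ : Euc d → ℂ, IsTest U ψ ∧ H1norm h U ψ ≤ 1 ∧
      r = ‖∫ x in U, v x * (starRingEnd ℂ) (ψ x)‖} := by
  have hv2 : Integrable (fun x => ‖v x‖ ^ 2) := hv.integrable_norm_pow (by simp)
  refine ⟨(∫ x in U, ‖v x‖ ^ 2) + 1, ?_⟩
  rintro r ⟨ψ, hψ, h1, rfl⟩
  have hψ2 : Integrable (fun x => ‖ψ x‖ ^ 2) :=
    (hψ.1.continuous.memLp_of_hasCompactSupport (p := 2) hψ.2.1).integrable_norm_pow (by simp)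
  have h2 : ∫ x in U, ‖ψ x‖ ^ 2 ≤ 1 := by
    have h3 : 0 ≤ h ^ 2 * ∫ x in U, ∑ j, ‖pd j ψ x‖ ^ 2 :=
      mul_nonneg (sq_nonneg _) (integral_nonneg fun x => by positivity)
    have h4 := (Real.sqrt_le_iff.1 h1).2
    linarith
  calc ‖∫ x in U, v x * (starRingEnd ℂ) (ψ x)‖
      ≤ ∫ x in U, (‖v x‖ ^ 2 + ‖ψ x‖ ^ 2) := by
        refine norm_integral_le_of_norm_le (hv2.add hψ2).integrableOn
          (Filter.Eventually.of_forall fun x => ?_)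
        simp only [norm_mul, RCLike.norm_conj]
        nlinarith [sq_nonneg (‖v x‖ - ‖ψ x‖), sq_nonneg (‖v x‖ + ‖ψ x‖)]
    _ = (∫ x in U, ‖v x‖ ^ 2) + ∫ x in U, ‖ψ x‖ ^ 2 :=
        integral_add hv2.integrableOn hψ2.integrableOn
    _ ≤ _ := by linarith

lemma Hneg1norm_nonneg (h : ℝ) (U : Set (Euc d)) (v : Euc d → ℂ) : 0 ≤ Hneg1norm h U v :=
  Real.sSup_nonneg (by rintro r ⟨ψ, -, -, rfl⟩; exact norm_nonneg _)

lemma norm_integral_le_Hneg1norm (h : ℝ) (U : Set (Euc d)) {v : Euc d → ℂ} (hv : MemLp v 2)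
    {ψ : Euc d → ℂ} (hψ : IsTest U ψ) {c : ℝ} (hc : 0 < c) (hψc : H1norm h U ψ ≤ c) :
    ‖∫ x, v x * (starRingEnd ℂ) (ψ x)‖ ≤ Hneg1norm h U v * c := by
  have h1 : ‖∫ x in U, v x * (starRingEnd ℂ) (((c⁻¹ : ℝ) : ℂ) * ψ x)‖ ≤ Hneg1norm h U v := by
    refine le_csSup (bddAbove_Hneg1norm h U hv) ⟨_, hψ.smul _, ?_, rfl⟩
    rw [H1norm_smul h U hψ.differentiable (by positivity)]
    rw [inv_mul_le_iff₀ hc]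
    simpa using hψc
  have h2 : ∫ x in U, v x * (starRingEnd ℂ) (((c⁻¹ : ℝ) : ℂ) * ψ x) =
      ((c⁻¹ : ℝ) : ℂ) * ∫ x, v x * (starRingEnd ℂ) (ψ x) := by
    rw [setIntegral_eq_integral_of_forall_compl_eq_zero, ← integral_const_mul]
    · refine integral_congr_ae (Filter.Eventually.of_forall fun x => ?_)
      simp only [map_mul, Complex.conj_ofReal]
      ring
    · intro x hx
      have : ψ x = 0 := image_eq_zero_of_notMem_tsupport fun h' => hx (hψ.2.2 h')
      simp [this]
  rw [h2, norm_mul, Complex.norm_real, Real.norm_of_nonneg (by positivity),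
    inv_mul_le_iff₀ hc] at h1
  linarith

end Integrals

section Energy

variable {d : ℕ}

/-- The density of the sesquilinear form `energy` with respect to the weight `dilWeight`. -/
def energyDensity (h : ℝ) (u v : Euc d → ℂ) (x : Euc d) : ℝ :=
  (u x * (starRingEnd ℂ) (v x)).re +
    h ^ 2 * (‖x‖ ^ 2 * ∑ j, (pd j u x * (starRingEnd ℂ) (pd j v x)).re)

/-- The real part of the dilation-invariant semiclassical `H¹` inner product. -/
def energy (h : ℝ) (u v : Euc d → ℂ) : ℝ := ∫ x, dilWeight x * energyDensity h u v x

/-- The real part of the dilation-invariant `L²` inner product. -/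
def pairing (z p : Euc d → ℂ) : ℝ := ∫ x, dilWeight x * (z x * (starRingEnd ℂ) (p x)).re

lemma re_mul_conj_self (z : ℂ) : (z * (starRingEnd ℂ) z).re = ‖z‖ ^ 2 := by
  rw [Complex.mul_conj, Complex.ofReal_re, Complex.normSq_eq_norm_sq]

lemma energyDensity_self (h : ℝ) (u : Euc d → ℂ) (x : Euc d) : energyDensity h u u x =
    ‖u x‖ ^ 2 + h ^ 2 * (‖x‖ ^ 2 * ∑ j, ‖pd j u x‖ ^ 2) := by
  simp only [energyDensity, re_mul_conj_self]

lemma dilWeight_continuousOn : ContinuousOn (dilWeight (d := d)) (Punct d) :=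
  (dilWeight_contDiffOn (k := 0)).continuousOn

lemma IsTest.integrable_pairing {z p : Euc d → ℂ} (hz : Continuous z) (hp : IsTest (Punct d) p) :
    Integrable fun x => dilWeight x * (z x * (starRingEnd ℂ) (p x)).re :=
  hp.integrable (dilWeight_continuousOn.mul (Complex.continuous_re.comp
    (hz.mul (Complex.continuous_conj.comp hp.1.continuous))).continuousOn)
    fun x hx => by simp [image_eq_zero_of_notMem_tsupport hx]

lemma IsTest.integrable_norm_sq {p : Euc d → ℂ} (hp : IsTest (Punct d) p) :
    Integrable fun x => dilWeight x * ‖p x‖ ^ 2 := by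
  simpa only [re_mul_conj_self] using hp.integrable_pairing hp.1.continuous

lemma IsTest.integrable_energyDensity (h : ℝ) {u v : Euc d → ℂ} (hu : IsTest (Punct d) u)
    (hv : IsTest (Punct d) v) : Integrable fun x => dilWeight x * energyDensity h u v x := by
  have c : ∀ {u v : Euc d → ℂ}, IsTest (Punct d) u → IsTest (Punct d) v →
      Continuous fun x => (u x * (starRingEnd ℂ) (v x)).re := fun hu hv =>
    Complex.continuous_re.comp (hu.1.continuous.mul (Complex.continuous_conj.comp hv.1.continuous))
  refine hu.integrable (dilWeight_continuousOn.mul (Continuous.continuousOn ?_)) fun x hx => by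
    simp [energyDensity, image_eq_zero_of_notMem_tsupport hx, pd_eq_zero _ hx]
  exact (c hu hv).add (continuous_const.mul ((continuous_norm.pow 2).mul
    (continuous_finsetSum _ fun j _ => c (hu.partialDeriv j) (hv.partialDeriv j))))

lemma energy_self_nonneg (h : ℝ) (u : Euc d → ℂ) : 0 ≤ energy h u u := by
  refine integral_nonneg fun x => mul_nonneg (dilWeight_pos x).le ?_
  rw [energyDensity_self]
  positivity

lemma pairing_self_nonneg (u : Euc d → ℂ) : 0 ≤ pairing u u := by
  refine integral_nonneg fun x => mul_nonneg (dilWeight_pos x).le ?_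
  rw [re_mul_conj_self]
  positivity

lemma pairing_self_le_energy (h : ℝ) {u : Euc d → ℂ} (hu : IsTest (Punct d) u) :
    pairing u u ≤ energy h u u := by
  refine integral_mono (hu.integrable_pairing hu.1.continuous) (hu.integrable_energyDensity h hu)
    fun x => mul_le_mul_of_nonneg_left ?_ (dilWeight_pos x).le
  rw [re_mul_conj_self, energyDensity_self]
  have : 0 ≤ h ^ 2 * (‖x‖ ^ 2 * ∑ j, ‖pd j u x‖ ^ 2) := by positivity
  linarith

lemma re_mul_conj_le (a b : ℂ) {s : ℝ} (hs : 0 < s) :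
    (a * (starRingEnd ℂ) b).re ≤ s * ‖a‖ ^ 2 + ‖b‖ ^ 2 / (4 * s) := by
  have h1 : (a * (starRingEnd ℂ) b).re ≤ ‖a‖ * ‖b‖ := by
    simpa using Complex.re_le_norm (a * (starRingEnd ℂ) b)
  have h2 : s * ‖a‖ ^ 2 + ‖b‖ ^ 2 / (4 * s) - ‖a‖ * ‖b‖ = (2 * s * ‖a‖ - ‖b‖) ^ 2 / (4 * s) := by
    field_simp
    ring
  have h3 : 0 ≤ (2 * s * ‖a‖ - ‖b‖) ^ 2 / (4 * s) := by positivity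
  linarith

lemma pairing_le {z p : Euc d → ℂ} (hz : IsTest (Punct d) z) (hp : IsTest (Punct d) p) {s : ℝ}
    (hs : 0 < s) : pairing z p ≤ s * pairing z z + pairing p p / (4 * s) := by
  have h1 := hz.integrable_pairing hz.1.continuous
  have h2 := hp.integrable_pairing hp.1.continuous
  rw [pairing, pairing, pairing, ← integral_const_mul, ← integral_div,
    ← integral_add (h1.const_mul s) (h2.div_const _)]
  refine integral_mono (hp.integrable_pairing hz.1.continuous)
    ((h1.const_mul s).add (h2.div_const _)) fun x => ?_
  have h3 := mul_le_mul_of_nonneg_left (re_mul_conj_le (z x) (p x) hs) (dilWeight_pos x).le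
  simp only [re_mul_conj_self]
  refine h3.trans_eq ?_
  ring

lemma energyDensity_add (h t : ℝ) {v p : Euc d → ℂ} {x : Euc d} (hv : DifferentiableAt ℝ v x)
    (hp : DifferentiableAt ℝ p x) :
    energyDensity h (fun y => v y + t * p y) (fun y => v y + t * p y) x =
      energyDensity h v v x + 2 * t * energyDensity h v p x + t ^ 2 * energyDensity h p p x := by
  have key : ∀ a b : ℂ, ((a + t * b) * (starRingEnd ℂ) (a + t * b)).re =
      (a * (starRingEnd ℂ) a).re + 2 * t * (a * (starRingEnd ℂ) b).re +
        t ^ 2 * (b * (starRingEnd ℂ) b).re := by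
    intro a b
    simp
    ring
  have h1 : ∀ j, pd j (fun y => v y + t * p y) x = pd j v x + t * pd j p x := fun j => by
    rw [pd_add j hv (hp.const_mul _), pd_const_mul _ j hp]
  simp only [energyDensity, h1, key, Finset.sum_add_distrib, ← Finset.mul_sum]
  ring

lemma energy_add (h t : ℝ) {v p : Euc d → ℂ} (hv : IsTest (Punct d) v)
    (hp : IsTest (Punct d) p) :
    energy h (fun y => v y + t * p y) (fun y => v y + t * p y) =
      energy h v v + 2 * t * energy h v p + t ^ 2 * energy h p p := by
  have h1 := hv.integrable_energyDensity h hv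
  have h2 := hv.integrable_energyDensity h hp
  have h3 := hp.integrable_energyDensity h hp
  have h4 : Integrable fun x => dilWeight x * energyDensity h v v x +
      2 * t * (dilWeight x * energyDensity h v p x) := h1.add (h2.const_mul _)
  simp only [energy]
  rw [← integral_const_mul, ← integral_const_mul, ← integral_add h1 (h2.const_mul _),
    ← integral_add h4 (h3.const_mul _)]
  refine integral_congr_ae (Filter.Eventually.of_forall fun x => ?_)
  simp only [energyDensity_add h t (hv.differentiable x) (hp.differentiable x)]
  ring

lemma pairing_add (t : ℝ) {z v p : Euc d → ℂ} (hz : IsTest (Punct d) z) (hv : IsTest (Punct d) v)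
    (hp : IsTest (Punct d) p) :
    pairing z (fun y => v y + t * p y) = pairing z v + t * pairing z p := by
  have h1 := hv.integrable_pairing hz.1.continuous
  have h2 := hp.integrable_pairing hz.1.continuous
  simp only [pairing]
  rw [← integral_const_mul, ← integral_add h1 (h2.const_mul _)]
  refine integral_congr_ae (Filter.Eventually.of_forall fun x => ?_)
  simp
  ring

lemma exists_near_minimizer (h : ℝ) {U : Set (Euc d)} (hU : U ⊆ Punct d) {z : Euc d → ℂ}
    (hz : IsTest (Punct d) z) {δ : ℝ} (hδ : 0 < δ) : ∃ v, IsTest U v ∧ ∀ p, IsTest U p →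
      energy h v v / 2 - pairing z v ≤ energy h p p / 2 - pairing z p + δ := by
  set S : Set ℝ := {r | ∃ v, IsTest U v ∧ r = energy h v v / 2 - pairing z v}
  have hS : BddBelow S := by
    refine ⟨-(pairing z z / 2), ?_⟩
    rintro r ⟨v, hv, rfl⟩
    have h1 := pairing_le hz (hv.mono hU) (s := 1 / 2) (by norm_num)
    have h2 := pairing_self_le_energy h (hv.mono hU)
    linarith
  have hne : S.Nonempty := ⟨_, _, IsTest.zero, rfl⟩
  obtain ⟨r, ⟨v, hv, rfl⟩, hr⟩ := exists_lt_of_csInf_lt hne (lt_add_of_pos_right (sInf S) hδ)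
  exact ⟨v, hv, fun p hp => hr.le.trans (by linarith [csInf_le hS ⟨p, hp, rfl⟩])⟩

lemma integral_dilWeight_mul_comp_smul [Nontrivial (Euc d)] (F : Euc d → ℝ) {c : ℝ} (hc : 0 < c) :
    ∫ x, dilWeight x * F (c • x) = ∫ x, dilWeight x * F x := by
  have h1 : ∀ᵐ x : Euc d, dilWeight x * F (c • x) =
      c ^ d * (fun y => dilWeight y * F y) (c • x) := by
    filter_upwards [ae_ne_zero] with x hx
    have h2 : dilWeight (c • x) = (c ^ d)⁻¹ * dilWeight x := by
      have h3 : carlWeight (c • x) = Real.log c + carlWeight x := by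
        rw [carlWeight, norm_smul, Real.norm_of_nonneg hc.le,
          Real.log_mul hc.ne' (norm_ne_zero_iff.2 hx), carlWeight]
      rw [dilWeight, h3, mul_add, neg_add, Real.exp_add, dilWeight, Real.exp_neg, Real.exp_nat_mul,
        Real.exp_log hc]
    have h4 : c ^ d ≠ 0 := (pow_pos hc d).ne'
    simp only [h2]
    field_simp
  rw [integral_congr_ae h1, integral_const_mul,
    Measure.integral_comp_smul volume (fun y => dilWeight y * F y) c]
  have h4 : 0 < c ^ d := pow_pos hc d
  rw [finrank_euclideanSpace_fin, abs_of_pos (inv_pos.2 h4), smul_eq_mul, ← mul_assoc,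
    mul_inv_cancel₀ h4.ne', one_mul]

lemma pd_comp_smul (c : ℝ) (j : Fin d) {u : Euc d → ℂ} {x : Euc d}
    (hu : DifferentiableAt ℝ u (c • x)) : pd j (fun y => u (c • y)) x = c * pd j u (c • x) := by
  have h1 : HasFDerivAt (fun y : Euc d => c • y) (c • ContinuousLinearMap.id ℝ (Euc d)) x :=
    (c • ContinuousLinearMap.id ℝ (Euc d)).hasFDerivAt
  simp only [pd]
  rw [show (fun y => u (c • y)) = u ∘ fun y => c • y from rfl,
    (HasFDerivAt.comp x hu.hasFDerivAt h1).fderiv]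
  simp

lemma energy_comp_smul [Nontrivial (Euc d)] (h : ℝ) {u : Euc d → ℂ} (hu : Differentiable ℝ u)
    {c : ℝ} (hc : 0 < c) :
    energy h (fun y => u (c • y)) (fun y => u (c • y)) = energy h u u := by
  have h1 : ∀ x, energyDensity h (fun y => u (c • y)) (fun y => u (c • y)) x =
      energyDensity h u u (c • x) := fun x => by
    simp only [energyDensity_self, pd_comp_smul c _ (hu (c • x)), norm_mul, norm_smul, mul_pow,
      ← Finset.mul_sum, Complex.norm_real]
    ring
  simp only [energy, h1]
  exact integral_dilWeight_mul_comp_smul _ hc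

lemma pairing_comp_smul [Nontrivial (Euc d)] (z v : Euc d → ℂ) {c : ℝ} (hc : 0 < c) :
    pairing z (fun y => v (c⁻¹ • y)) = pairing (fun y => z (c • y)) v := by
  rw [pairing, pairing, ← integral_dilWeight_mul_comp_smul _ hc]
  simp [smul_smul, inv_mul_cancel₀ hc.ne']

lemma IsTest.comp_smul {U : Set (Euc d)} {v : Euc d → ℂ} (hv : IsTest U v) {c : ℝ} (hc : 0 < c)
    (hU : ∀ x ∈ U, c⁻¹ • x ∈ U) : IsTest U fun y => v (c • y) := by
  have h1 : tsupport (fun y => v (c • y)) ⊆ (fun y => c • y) ⁻¹' tsupport v :=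
    tsupport_comp_subset_preimage v (continuous_const_smul c)
  refine ⟨hv.1.comp (contDiff_const_smul c),
    hv.2.1.comp_homeomorph (Homeomorph.smulOfNeZero c hc.ne'), fun x hx => ?_⟩
  have := hU _ (hv.2.2 (h1 hx))
  rwa [smul_smul, inv_mul_cancel₀ hc.ne', one_smul] at this

end Energy

section ApproximateSolution

variable {d : ℕ}

/-- The radial derivative `x · ∇u`. -/
def eulerDeriv (u : Euc d → ℂ) (x : Euc d) : ℂ := fderiv ℝ u x x

lemma eulerDeriv_eq_sum (u : Euc d → ℂ) (x : Euc d) :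
    eulerDeriv u x = ∑ j, (x j : ℂ) * pd j u x := by
  simp [eulerDeriv, fderiv_apply_eq_sum]

lemma IsTest.eulerDeriv {U : Set (Euc d)} {u : Euc d → ℂ} (hu : IsTest U u) :
    IsTest U (eulerDeriv u) := by
  have h0 : tsupport (_root_.eulerDeriv u) ⊆ tsupport u := by
    refine closure_minimal (fun x hx => ?_) (isClosed_tsupport u)
    by_contra h
    exact hx (by simp [eulerDeriv_eq_sum, pd_eq_zero _ h])
  exact ⟨(hu.1.fderiv_right (m := (⊤ : ℕ∞)) (by exact_mod_cast le_rfl)).clm_apply contDiff_id,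
    hu.2.1.of_isClosed_subset (isClosed_tsupport _) h0, h0.trans hu.2.2⟩

/-- The open annulus with radii `ρ < R`. -/
def annulus (d : ℕ) (ρ R : ℝ) : Set (Euc d) := {x | ρ < ‖x‖ ∧ ‖x‖ < R}

lemma annulus_subset_punct {ρ R : ℝ} (hρ : 0 ≤ ρ) : annulus d ρ R ⊆ Punct d :=
  fun _ hx => norm_pos_iff.1 (hρ.trans_lt hx.1)

lemma IsTest.taylor {U : Set (Euc d)} {z : Euc d → ℂ} (hz : IsTest U z) :
    ∃ L : ℝ, ∀ (x : Euc d) (s : ℝ),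
      ‖z x + s * _root_.eulerDeriv z x - z ((1 + s) • x)‖ ≤ L * s ^ 2 * ‖x‖ ^ 2 := by
  obtain ⟨L, hL⟩ := ((hz.1.fderiv_right (m := (⊤ : ℕ∞)) (by exact_mod_cast le_rfl)).of_le
    (m := 1) (by exact_mod_cast le_top)).lipschitzWith_of_hasCompactSupport
      (hz.2.1.fderiv ℝ) (by simp)
  refine ⟨L, fun x s => ?_⟩
  have h1 : (1 + s) • x - x = s • x := by rw [add_smul, one_smul, add_sub_cancel_left]
  have h2 := (convex_closedBall x ‖s • x‖).norm_image_sub_le_of_norm_fderiv_le' (𝕜 := ℝ) (f := z)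
    (C := L * ‖s • x‖) (φ := fderiv ℝ z x) (x := x) (y := (1 + s) • x)
    (fun y _ => hz.differentiable y) (fun y hy => (hL.norm_sub_le y x).trans
      (mul_le_mul_of_nonneg_left (by simpa [dist_eq_norm] using hy) L.2))
    (Metric.mem_closedBall_self (norm_nonneg _)) (by simp [dist_eq_norm, h1])
  rw [h1, map_smul, norm_smul, Real.norm_eq_abs] at h2
  rw [← norm_neg, _root_.eulerDeriv]
  calc _ = ‖z ((1 + s) • x) - z x - s • (fderiv ℝ z x) x‖ := by
        congr 1
        simp
        ring
    _ ≤ _ := h2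
    _ = L * |s| ^ 2 * ‖x‖ ^ 2 := by ring
    _ = _ := by rw [sq_abs]

lemma IsTest.taylor_pairing {ρ R : ℝ} (hρ : 0 < ρ) {z : Euc d → ℂ} (hz : IsTest (annulus d ρ R) z) :
    ∃ K : ℝ, 0 ≤ K ∧ ∀ s ∈ Ioc (0 : ℝ) 1,
      pairing (fun x => z x + s * _root_.eulerDeriv z x - z ((1 + s) • x))
        (fun x => z x + s * _root_.eulerDeriv z x - z ((1 + s) • x)) ≤ K * s ^ 4 := by
  obtain ⟨L, hL⟩ := hz.taylor
  set B : Set (Euc d) := Metric.closedBall 0 R \ Metric.ball 0 (ρ / 2)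
  have hB : IsCompact B := (isCompact_closedBall 0 R).diff Metric.isOpen_ball
  have hB' : B ⊆ Punct d := fun x hx => norm_pos_iff.1 (by
    have := hx.2
    simp only [Metric.mem_ball, dist_zero_right, not_lt] at this
    linarith)
  have hi : IntegrableOn (fun x : Euc d => dilWeight x * (L * ‖x‖ ^ 2) ^ 2) B :=
    ContinuousOn.integrableOn_compact hB ((dilWeight_continuousOn.mono hB').mul
      (by fun_prop : Continuous fun x : Euc d => (L * ‖x‖ ^ 2) ^ 2).continuousOn)
  refine ⟨∫ x in B, dilWeight x * (L * ‖x‖ ^ 2) ^ 2,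
    integral_nonneg fun x => mul_nonneg (dilWeight_pos x).le (sq_nonneg _), fun s hs => ?_⟩
  have h0 : ∀ x ∉ B, z x + s * _root_.eulerDeriv z x - z ((1 + s) • x) = 0 := by
    intro x hx
    have hx' : ‖x‖ ≤ R → ‖x‖ < ρ / 2 := by
      intro h
      by_contra h'
      exact hx ⟨by simpa using h, by simpa using h'⟩
    have hn : ‖(1 + s) • x‖ = (1 + s) * ‖x‖ := by
      rw [norm_smul, Real.norm_of_nonneg (by linarith [hs.1])]
    have h1 : ∀ y : Euc d, ‖y‖ = ‖x‖ ∨ ‖y‖ = (1 + s) * ‖x‖ → y ∉ annulus d ρ R := by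
      rintro y hy ⟨h1, h2⟩
      have h5 : ‖x‖ ≤ ‖y‖ ∧ ‖y‖ ≤ 2 * ‖x‖ := by
        rcases hy with hy | hy <;> rw [hy] <;> constructor <;>
          nlinarith [hs.1, hs.2, norm_nonneg x]
      linarith [hx' (by linarith)]
    have h2 := image_eq_zero_of_notMem_tsupport fun h => h1 x (Or.inl rfl) (hz.2.2 h)
    have h3 := image_eq_zero_of_notMem_tsupport fun h => h1 _ (Or.inr hn) (hz.2.2 h)
    have h4 := image_eq_zero_of_notMem_tsupport fun h =>
      h1 x (Or.inl rfl) (hz.eulerDeriv.2.2 h)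
    rw [h2, h3, h4]
    simp
  rw [pairing, ← setIntegral_eq_integral_of_forall_compl_eq_zero (s := B)
    (fun x hx => by rw [h0 x hx]; simp), ← integral_mul_const]
  refine integral_mono_of_nonneg (Filter.Eventually.of_forall fun x =>
    mul_nonneg (dilWeight_pos x).le (by rw [re_mul_conj_self]; positivity)) (hi.mul_const _)
    (Filter.Eventually.of_forall fun x => ?_)
  simp only [re_mul_conj_self]
  rw [mul_assoc]
  refine mul_le_mul_of_nonneg_left ?_ (dilWeight_pos x).le
  calc _ ≤ (L * s ^ 2 * ‖x‖ ^ 2) ^ 2 := pow_le_pow_left₀ (norm_nonneg _) (hL x s) 2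
    _ = _ := by ring

/-- An almost minimizer of `v ↦ energy v v / 2 - pairing z v` on a domain invariant under
expanding dilations is an almost solution of the Euler-Lagrange equation, and it correlates
at most negligibly with the radial derivative of the datum. -/
lemma exists_approximate_solution [Nontrivial (Euc d)] (h : ℝ) {U : Set (Euc d)} (hU : U ⊆ Punct d)
    (hUs : ∀ x ∈ U, ∀ c : ℝ, 1 ≤ c → c • x ∈ U) {ρ R : ℝ} (hρ : 0 < ρ) {z : Euc d → ℂ}
    (hz : IsTest (annulus d ρ R) z) {η : ℝ} (hη : 0 < η) : ∃ v, IsTest U v ∧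
      (∀ p, IsTest U p → -(energy h p p / 8) - η ≤ energy h v p - pairing z p) ∧
      pairing (eulerDeriv z) v ≤ η := by
  have hz' : IsTest (Punct d) z := hz.mono (annulus_subset_punct hρ.le)
  obtain ⟨K, hK0, hK⟩ := hz.taylor_pairing hρ
  set V : ℝ := 4 * (pairing z z + 1)
  have hV : 0 < V := by have := pairing_self_nonneg z; positivity
  obtain ⟨s, hs0, hs1, hs⟩ : ∃ s : ℝ, 0 < s ∧ s ≤ 1 ∧ (K + V) * s ≤ η / 2 := by
    refine ⟨min 1 (η / 2 / (K + V)), by positivity, min_le_left _ _, ?_⟩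
    calc _ ≤ (K + V) * (η / 2 / (K + V)) := by gcongr; exact min_le_right _ _
      _ = _ := by field_simp
  obtain ⟨δ, hδ0, hδ1, hδ2, hδ3⟩ : ∃ δ : ℝ, 0 < δ ∧ δ ≤ 1 ∧ 4 * δ ≤ η ∧ δ ≤ s * (η / 2) := by
    refine ⟨min 1 (min (η / 4) (s * (η / 2))), by positivity, min_le_left _ _, ?_, ?_⟩
    · linarith [(min_le_right 1 (min (η / 4) (s * (η / 2)))).trans (min_le_left _ _)]
    · exact (min_le_right 1 (min (η / 4) (s * (η / 2)))).trans (min_le_right _ _)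
  obtain ⟨v, hv, hmin⟩ := exists_near_minimizer h hU hz' hδ0
  have hv' := hv.mono hU
  refine ⟨v, hv, fun p hp => ?_, ?_⟩
  · have h1 := hmin _ (hv.add (hp.smul ((1 / 4 : ℝ) : ℂ)))
    rw [energy_add h _ hv' (hp.mono hU), pairing_add _ hz' hv' (hp.mono hU)] at h1
    linarith
  have hvV : pairing v v ≤ V := by
    have h1 := hmin _ IsTest.zero
    have h2 := pairing_le hz' hv' (s := 1) one_pos
    have h3 := pairing_self_le_energy h hv'
    have h4 : energy h (fun _ : Euc d => (0 : ℂ)) (fun _ => 0) = 0 := by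
      simp [energy, energyDensity_self, pd_const]
    have h5 : pairing z (fun _ => (0 : ℂ)) = 0 := by simp [pairing]
    rw [h4, h5] at h1
    linarith
  have hc : 0 < (1 + s)⁻¹ := by positivity
  have h1 := hmin _ (hv.comp_smul hc fun x hx => by
    rw [inv_inv]; exact hUs x hx _ (by linarith))
  rw [energy_comp_smul h hv.differentiable hc, pairing_comp_smul _ _ (by positivity)] at h1
  have hzs : IsTest (Punct d) fun y => z ((1 + s) • y) :=
    hz'.comp_smul (by positivity) fun x hx => smul_ne_zero hc.ne' hx
  have hrem : IsTest (Punct d) fun x => z x + s * eulerDeriv z x - z ((1 + s) • x) :=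
    (hz'.add (hz'.eulerDeriv.smul s)).sub hzs
  have h2 : pairing (fun x => z x + s * eulerDeriv z x - z ((1 + s) • x)) v =
      pairing z v + s * pairing (eulerDeriv z) v - pairing (fun x => z ((1 + s) • x)) v := by
    have i1 := hv'.integrable_pairing hz.1.continuous
    have i2 := (hv'.integrable_pairing hz.eulerDeriv.1.continuous).const_mul s
    have i3 := hv'.integrable_pairing hzs.1.continuous
    have i4 : Integrable fun x => dilWeight x * (z x * (starRingEnd ℂ) (v x)).re +
        s * (dilWeight x * (eulerDeriv z x * (starRingEnd ℂ) (v x)).re) := i1.add i2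
    simp only [pairing]
    rw [← integral_const_mul, ← integral_add i1 i2, ← integral_sub i4 i3]
    refine integral_congr_ae (Filter.Eventually.of_forall fun x => ?_)
    simp
    ring
  have h3 := pairing_le hrem hv' (s := (s ^ 2)⁻¹) (by positivity)
  have h4 : (s ^ 2)⁻¹ * pairing (fun x => z x + s * eulerDeriv z x - z ((1 + s) • x))
      (fun x => z x + s * eulerDeriv z x - z ((1 + s) • x)) ≤ K * s ^ 2 := by
    calc _ ≤ (s ^ 2)⁻¹ * (K * s ^ 4) := by gcongr; exact hK s ⟨hs0, hs1⟩
      _ = _ := by field_simp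
  have h5 : pairing v v / (4 * (s ^ 2)⁻¹) ≤ V * s ^ 2 := by
    calc _ = pairing v v * s ^ 2 / 4 := by field_simp
      _ ≤ V * s ^ 2 / 4 := by gcongr
      _ ≤ _ := by have : 0 ≤ V * s ^ 2 := by positivity
                  linarith
  have h6 : s * pairing (eulerDeriv z) v ≤ s * η := by nlinarith
  exact le_of_mul_le_mul_left h6 hs0

end ApproximateSolution

section PointwiseIdentity

variable {d : ℕ}

lemma eulerDeriv_mul {u v : Euc d → ℂ} {x : Euc d} (hu : DifferentiableAt ℝ u x)
    (hv : DifferentiableAt ℝ v x) :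
    eulerDeriv (fun y => u y * v y) x = eulerDeriv u x * v x + u x * eulerDeriv v x := by
  simp only [eulerDeriv, fderiv_fun_mul hu hv]
  simp
  ring

lemma eulerDeriv_conj {u : Euc d → ℂ} {x : Euc d} (hu : DifferentiableAt ℝ u x) :
    eulerDeriv (fun y => (starRingEnd ℂ) (u y)) x = (starRingEnd ℂ) (eulerDeriv u x) := by
  simp [eulerDeriv_eq_sum, pd_conj _ hu]

/-- The quantity `h x · ∇(φ/h + φ²/(2ε))`. -/
def convFactor (h ε : ℝ) (x : Euc d) : ℝ := 1 + h / ε * carlWeight x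

lemma convFactor_contDiffAt (h ε : ℝ) {x : Euc d} (hx : x ≠ 0) {k : WithTop ℕ∞} :
    ContDiffAt ℝ k (convFactor (d := d) h ε) x :=
  contDiffAt_const.add (contDiffAt_const.mul (carlWeight_contDiffAt hx))

lemma pd_convFactor (h ε : ℝ) (j : Fin d) {x : Euc d} (hx : x ≠ 0) :
    pd j (convFactor h ε) x = h / ε * (x j / ‖x‖ ^ 2) := by
  have hd : DifferentiableAt ℝ (carlWeight (d := d)) x :=
    (carlWeight_contDiffAt (k := 1) hx).differentiableAt (by simp)
  unfold convFactor
  rw [pd_add j (differentiableAt_const _) (hd.const_mul _), pd_const,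
    pd_mul j (differentiableAt_const _) hd, pd_const, pd_carlWeight j hx]
  ring

lemma eulerDeriv_convFactor (h ε : ℝ) {x : Euc d} (hx : x ≠ 0) :
    eulerDeriv (fun y => ((convFactor h ε y : ℝ) : ℂ)) x = ((h / ε : ℝ) : ℂ) := by
  have hd : DifferentiableAt ℝ (convFactor (d := d) h ε) x :=
    (convFactor_contDiffAt (k := 1) h ε hx).differentiableAt (by simp)
  have hx' : ‖x‖ ^ 2 ≠ 0 := by positivity
  simp only [eulerDeriv_eq_sum, pd_ofReal _ hd, pd_convFactor _ _ _ hx]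
  norm_cast
  calc _ = h / ε * (∑ j, x j ^ 2) / ‖x‖ ^ 2 := by
        rw [Finset.mul_sum, Finset.sum_div]
        exact Finset.sum_congr rfl fun j _ => by ring
    _ = _ := by rw [sum_coord_sq, mul_div_assoc, div_self hx', mul_one]

lemma pd_normSq_mul_dilWeight (j : Fin d) {x : Euc d} (hx : x ≠ 0) :
    pd j (fun y : Euc d => ‖y‖ ^ 2 * dilWeight y) x = (2 - d) * x j * dilWeight x := by
  have h1 : DifferentiableAt ℝ (fun y : Euc d => ‖y‖ ^ 2) x :=
    (hasStrictFDerivAt_norm_sq x).hasFDerivAt.differentiableAt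
  have h2 : DifferentiableAt ℝ (dilWeight (d := d)) x :=
    (dilWeight_contDiffAt (k := 1) hx).differentiableAt (by simp)
  have h3 : pd j (fun y : Euc d => ‖y‖ ^ 2) x = 2 * x j := by
    simp only [pd]
    rw [(hasStrictFDerivAt_norm_sq x).hasFDerivAt.fderiv]
    simp [EuclideanSpace.inner_single_right]
  rw [pd_mul j h1 h2, pd_dilWeight j hx, h3]
  field_simp
  ring

/-- The perturbative part of the weak formulation. -/
def weakRemainder (h ε : ℝ) (W : Euc d → Euc d) (q : Euc d → ℂ) (w p : Euc d → ℂ) (x : Euc d) :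
    ℂ :=
  w x * ((starRingEnd ℂ) (p x) *
      (-(1 - (convFactor h ε x : ℂ)) ^ 2 - h ^ 2 / ε - h * convFactor h ε x * (2 - d) +
        h ^ 2 * ‖x‖ ^ 2 * (Complex.I * ((∑ j, pd j (fun y => W y j) x : ℝ) : ℂ) +
          ((‖W x‖ ^ 2 : ℝ) : ℂ) + q x) +
        2 * Complex.I * (h ^ 2 * (2 - d) + h * convFactor h ε x) *
          ∑ j, ((W x j : ℝ) : ℂ) * x j) -
    h ^ 2 * (2 - d) * ∑ j, (x j : ℂ) * (starRingEnd ℂ) (pd j p x) +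
    2 * Complex.I * h ^ 2 * ‖x‖ ^ 2 * ∑ j, ((W x j : ℝ) : ℂ) * (starRingEnd ℂ) (pd j p x))

lemma weakIntegrand_eq {h ε : ℝ} (hh : h ≠ 0) (hε : ε ≠ 0) (W : Euc d → Euc d) (q : Euc d → ℂ)
    {w p : Euc d → ℂ} {x : Euc d} (hx : x ≠ 0) (hw : DifferentiableAt ℝ w x)
    (hp : DifferentiableAt ℝ p x) :
    weakIntegrand h ε W q w (fun y => ((‖y‖ ^ 2 * dilWeight y : ℝ) : ℂ) * p y) x =
      (dilWeight x : ℂ) * (w x * (starRingEnd ℂ) (p x) +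
        h ^ 2 * (‖x‖ ^ 2 * ∑ j, pd j w x * (starRingEnd ℂ) (pd j p x)) -
        2 * convFactor h ε x * w x * (starRingEnd ℂ) (p x) +
        h * (eulerDeriv (fun y => 2 * (convFactor h ε y : ℂ) * w y) x * (starRingEnd ℂ) (p x)) +
        eulerDeriv (fun y => (h ^ 2 * (2 - d) - h * (convFactor h ε y : ℂ)) *
          (w y * (starRingEnd ℂ) (p y))) x + weakRemainder h ε W q w p x) := by
  have hμ : DifferentiableAt ℝ (fun y : Euc d => ‖y‖ ^ 2 * dilWeight y) x :=
    (hasStrictFDerivAt_norm_sq x).hasFDerivAt.differentiableAt.mul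
      ((dilWeight_contDiffAt (k := 1) hx).differentiableAt (by simp))
  have ha : DifferentiableAt ℝ (fun y : Euc d => (convFactor h ε y : ℂ)) x :=
    differentiableAt_ofReal ((convFactor_contDiffAt (k := 1) h ε hx).differentiableAt (by simp))
  have hconst : ∀ c : ℂ, eulerDeriv (fun _ : Euc d => c) x = 0 := fun c => by simp [eulerDeriv]
  have hz : eulerDeriv (fun y => 2 * (convFactor h ε y : ℂ) * w y) x =
      2 * ((h / ε : ℝ) : ℂ) * w x + 2 * convFactor h ε x * eulerDeriv w x := by
    rw [eulerDeriv_mul (ha.const_mul _) hw, eulerDeriv_mul (differentiableAt_const _) ha,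
      eulerDeriv_convFactor h ε hx, hconst]
    ring
  have hb : eulerDeriv (fun y : Euc d => (h ^ 2 * (2 - d) - h * (convFactor h ε y : ℂ))) x =
      -(h * ((h / ε : ℝ) : ℂ)) := by
    have h2 : eulerDeriv (fun y => (h : ℂ) * (convFactor h ε y : ℂ)) x =
        h * ((h / ε : ℝ) : ℂ) := by
      rw [eulerDeriv_mul (differentiableAt_const _) ha, hconst, eulerDeriv_convFactor h ε hx]
      ring
    rw [← h2, eulerDeriv, eulerDeriv, fderiv_const_sub]
    simp
  have hg : eulerDeriv (fun y => (h ^ 2 * (2 - d) - h * (convFactor h ε y : ℂ)) *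
      (w y * (starRingEnd ℂ) (p y))) x =
      -(h * ((h / ε : ℝ) : ℂ)) * (w x * (starRingEnd ℂ) (p x)) +
        (h ^ 2 * (2 - d) - h * (convFactor h ε x : ℂ)) * (eulerDeriv w x * (starRingEnd ℂ) (p x) +
          w x * (starRingEnd ℂ) (eulerDeriv p x)) := by
    rw [eulerDeriv_mul ((ha.const_mul _).const_sub _) (hw.fun_mul (differentiableAt_conj hp)), hb,
      eulerDeriv_mul hw (differentiableAt_conj hp), eulerDeriv_conj hp]
  have hψ : ∀ j, (starRingEnd ℂ) (pd j (fun y => ((‖y‖ ^ 2 * dilWeight y : ℝ) : ℂ) * p y) x) =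
      (2 - d) * dilWeight x * (x j * (starRingEnd ℂ) (p x)) +
        ‖x‖ ^ 2 * dilWeight x * (starRingEnd ℂ) (pd j p x) := fun j => by
    rw [pd_mul j (differentiableAt_ofReal hμ) hp, pd_ofReal j hμ, pd_normSq_mul_dilWeight j hx]
    simp [map_ofNat]
    ring
  have hΦ : ∀ j, ((pd j (convWeight h ε) x : ℝ) : ℂ) =
      convFactor h ε x / (h * ‖x‖ ^ 2) * x j := fun j => by
    rw [pd_convWeight h hε j hx, convFactor]
    norm_cast
    field_simp
  have hr : ∑ j, (x j : ℂ) * x j = ‖x‖ ^ 2 := by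
    rw [← Complex.ofReal_pow, ← sum_coord_sq]
    push_cast
    simp only [sq]
  have hr0 : (‖x‖ : ℂ) ≠ 0 := by exact_mod_cast norm_ne_zero_iff.2 hx
  have hh0 : (h : ℂ) ≠ 0 := by exact_mod_cast hh
  have hEp : (starRingEnd ℂ) (eulerDeriv p x) = ∑ j, (x j : ℂ) * (starRingEnd ℂ) (pd j p x) := by
    simp [eulerDeriv_eq_sum]
  have s1 : ∀ (k b c P u : ℂ) (D Q : Fin d → ℂ), ∑ j, (D j - k * x j * u) *
      ((b * (x j * P) + c * Q j) + k * x j * (c * P)) = c * ∑ j, D j * Q j +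
        (b + k * c) * P * ∑ j, (x j : ℂ) * D j - k * u * c * ∑ j, (x j : ℂ) * Q j -
        k * u * (b + k * c) * P * ∑ j, (x j : ℂ) * x j := by
    intro k b c P u D Q
    simp only [Finset.mul_sum, ← Finset.sum_add_distrib, ← Finset.sum_sub_distrib]
    exact Finset.sum_congr rfl fun j _ => by ring
  have s2 : ∀ (b c P : ℂ) (V Q : Fin d → ℂ), ∑ j, V j * (b * (x j * P) + c * Q j) =
      b * P * ∑ j, V j * x j + c * ∑ j, V j * Q j := by
    intro b c P V Q
    simp only [Finset.mul_sum, ← Finset.sum_add_distrib]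
    exact Finset.sum_congr rfl fun j _ => by ring
  have s3 : ∀ (k : ℂ) (V : Fin d → ℂ), ∑ j, V j * (k * x j) = k * ∑ j, V j * x j := by
    intro k V
    simp only [Finset.mul_sum]
    exact Finset.sum_congr rfl fun j _ => by ring
  have hψ0 : (starRingEnd ℂ) (((‖x‖ ^ 2 * dilWeight x : ℝ) : ℂ) * p x) =
      ‖x‖ ^ 2 * dilWeight x * (starRingEnd ℂ) (p x) := by simp
  rw [hz, hg, hEp, weakRemainder, eulerDeriv_eq_sum w]
  simp only [weakIntegrand]
  simp only [hψ, hΦ, hψ0, s1, s2, s3, hr]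
  push_cast
  generalize ∑ j, pd j w x * (starRingEnd ℂ) (pd j p x) = A
  generalize ∑ j, (x j : ℂ) * pd j w x = Ew
  generalize ∑ j, (x j : ℂ) * (starRingEnd ℂ) (pd j p x) = Ep
  generalize ∑ j, ((W x j : ℝ) : ℂ) * (x j : ℂ) = WX
  generalize ∑ j, ((W x j : ℝ) : ℂ) * (starRingEnd ℂ) (pd j p x) = WP
  generalize (starRingEnd ℂ) (p x) = P
  generalize (convFactor h ε x : ℂ) = a
  generalize ∑ j, ((pd j (fun y => W y j) x : ℝ) : ℂ) = D
  generalize (dilWeight x : ℂ) = m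
  generalize w x = w
  generalize (h : ℂ) = h at *
  generalize (ε : ℂ) = ε at *
  generalize (‖x‖ : ℂ) = r at *
  field_simp
  ring

end PointwiseIdentity

section Remainder

variable {d : ℕ}

lemma abs_coord_le (x : Euc d) (j : Fin d) : |x j| ≤ ‖x‖ := by
  simpa using PiLp.norm_apply_le x j

lemma abs_carlWeight_le {ρ R : ℝ} (hρ : 0 < ρ) {x : Euc d} (hx : x ∈ annulus d ρ R) :
    |carlWeight x| ≤ |Real.log ρ| + |Real.log R| := by
  have h1 := Real.log_le_log hρ hx.1.le
  have h2 := Real.log_le_log (hρ.trans hx.1) hx.2.le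
  rw [carlWeight, abs_le]
  constructor
  · linarith [neg_abs_le (Real.log ρ), abs_nonneg (Real.log R)]
  · linarith [le_abs_self (Real.log R), abs_nonneg (Real.log ρ)]

lemma norm_mul_sub_add_le (c a₁ a₂ a₃ a₄ a₅ b₁ b₂ : ℂ) :
    ‖c * (a₁ - a₂ - a₃ + a₄ + a₅) - b₁ + b₂‖ ≤
      ‖c‖ * (‖a₁‖ + ‖a₂‖ + ‖a₃‖ + ‖a₄‖ + ‖a₅‖) + ‖b₁‖ + ‖b₂‖ := by
  have h₁ := norm_sub_le a₁ a₂
  have h₂ := norm_sub_le (a₁ - a₂) a₃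
  have h₃ := norm_add_le (a₁ - a₂ - a₃) a₄
  have h₄ := norm_add_le (a₁ - a₂ - a₃ + a₄) a₅
  refine (norm_add_le _ _).trans (add_le_add_left ((norm_sub_le _ _).trans
    (add_le_add_left ?_ _)) _)
  rw [norm_mul]
  exact mul_le_mul_of_nonneg_left (by linarith) (norm_nonneg c)

lemma norm_weakRemainder_le {h ε T R B D M : ℝ} (hε : 0 < ε) (hh : 0 < h) (h1 : h ≤ 1)
    (h2 : h ≤ ε) (h3 : h ≤ ε ^ 2) (W : Euc d → Euc d) (q w p : Euc d → ℂ) {x : Euc d}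
    (hT : |carlWeight x| ≤ T) (hR : ‖x‖ ≤ R) (hB : ‖W x‖ ≤ B)
    (hD : |∑ j, pd j (fun y => W y j) x| ≤ D) (hM : ‖q x‖ ≤ M) :
    ‖weakRemainder h ε W q w p x‖ ≤ ‖w x‖ * h *
      ((T ^ 2 + 1 + (1 + T) * (d + 2) + R ^ 2 * (D + B ^ 2 + M) +
        2 * (d + 2 + (1 + T)) * (d * (B * R))) * ‖p x‖ +
        (d + 2 + 2 * (B * R)) * (h * (‖x‖ * ∑ j, ‖pd j p x‖))) := by
  have hT0 : 0 ≤ T := (abs_nonneg _).trans hT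
  have hR0 : 0 ≤ R := (norm_nonneg _).trans hR
  have hB0 : 0 ≤ B := (norm_nonneg _).trans hB
  have hhε : h / ε ≤ 1 := (div_le_one hε).2 h2
  have hsub : 1 - convFactor h ε x = -(h / ε * carlWeight x) := by rw [convFactor]; ring
  have ha1 : (1 - convFactor h ε x) ^ 2 ≤ h * T ^ 2 := by
    have e1 : carlWeight x ^ 2 ≤ T ^ 2 := sq_le_sq' (by linarith [(abs_le.1 hT).1]) (abs_le.1 hT).2
    have e2 : (h / ε) ^ 2 ≤ h := by
      rw [div_pow, div_le_iff₀ (by positivity)]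
      nlinarith
    rw [hsub, neg_sq, mul_pow]
    gcongr
  have ha2 : |convFactor h ε x| ≤ 1 + T := by
    rw [convFactor]
    refine (abs_add_le _ _).trans ?_
    rw [abs_one, abs_mul, abs_of_pos (div_pos hh hε)]
    have : h / ε * |carlWeight x| ≤ 1 * T := by gcongr
    linarith
  have hd : ‖(2 - d : ℂ)‖ ≤ d + 2 := by
    refine (norm_sub_le _ _).trans ?_
    simp [add_comm]
  have hWX : ‖∑ j, ((W x j : ℝ) : ℂ) * x j‖ ≤ d * (B * R) := by
    refine (norm_sum_le _ _).trans ?_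
    refine (Finset.sum_le_card_nsmul _ _ (B * R) fun j _ => ?_).trans_eq (by simp)
    rw [norm_mul, Complex.norm_real, Complex.norm_real]
    exact mul_le_mul ((abs_coord_le _ _).trans hB) ((abs_coord_le _ _).trans hR) (norm_nonneg _) hB0
  have hWP : ‖∑ j, ((W x j : ℝ) : ℂ) * (starRingEnd ℂ) (pd j p x)‖ ≤ B * ∑ j, ‖pd j p x‖ := by
    rw [Finset.mul_sum]
    refine norm_sum_le_of_le _ fun j _ => ?_
    rw [norm_mul, Complex.norm_real, RCLike.norm_conj]
    exact mul_le_mul_of_nonneg_right ((abs_coord_le _ _).trans hB) (norm_nonneg _)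
  have hXP : ‖∑ j, (x j : ℂ) * (starRingEnd ℂ) (pd j p x)‖ ≤ ‖x‖ * ∑ j, ‖pd j p x‖ := by
    rw [Finset.mul_sum]
    refine norm_sum_le_of_le _ fun j _ => ?_
    rw [norm_mul, Complex.norm_real, RCLike.norm_conj]
    exact mul_le_mul_of_nonneg_right (abs_coord_le _ _) (norm_nonneg _)
  have hna : ‖(convFactor h ε x : ℂ)‖ ≤ 1 + T := by rwa [Complex.norm_real]
  have hnh : ‖(h : ℂ)‖ = h := by rw [Complex.norm_real, Real.norm_of_nonneg hh.le]
  have hnr : ‖(‖x‖ : ℂ)‖ = ‖x‖ := by simp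
  have hh2 : h ^ 2 ≤ h := by nlinarith
  have t1 : ‖-(1 - (convFactor h ε x : ℂ)) ^ 2‖ ≤ h * T ^ 2 := by
    rw [norm_neg, ← Complex.ofReal_one, ← Complex.ofReal_sub, ← Complex.ofReal_pow,
      Complex.norm_real, Real.norm_of_nonneg (sq_nonneg _)]
    exact ha1
  have t2 : ‖(h : ℂ) ^ 2 / ε‖ ≤ h * 1 := by
    rw [norm_div, norm_pow, hnh, Complex.norm_real, Real.norm_of_nonneg hε.le, sq, mul_div_assoc]
    gcongr
  have t3 : ‖(h : ℂ) * convFactor h ε x * (2 - d)‖ ≤ h * ((1 + T) * (d + 2)) := by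
    rw [norm_mul, norm_mul, hnh, mul_assoc]
    gcongr
  have t4 : ‖(h : ℂ) ^ 2 * ‖x‖ ^ 2 * (Complex.I * ((∑ j, pd j (fun y => W y j) x : ℝ) : ℂ) +
      ((‖W x‖ ^ 2 : ℝ) : ℂ) + q x)‖ ≤ h * (R ^ 2 * (D + B ^ 2 + M)) := by
    rw [norm_mul, norm_mul, norm_pow, norm_pow, hnh, hnr, mul_assoc]
    have e : ‖Complex.I * ((∑ j, pd j (fun y => W y j) x : ℝ) : ℂ) +
      ((‖W x‖ ^ 2 : ℝ) : ℂ) + q x‖ ≤ D + B ^ 2 + M := by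
      refine (norm_add_le _ _).trans (add_le_add ((norm_add_le _ _).trans
        (add_le_add ?_ ?_)) hM)
      · rwa [norm_mul, Complex.norm_I, one_mul, Complex.norm_real]
      · rw [Complex.norm_real, Real.norm_of_nonneg (sq_nonneg _)]
        gcongr
    gcongr
  have t5 : ‖2 * Complex.I * ((h : ℂ) ^ 2 * (2 - d) + h * convFactor h ε x) *
      ∑ j, ((W x j : ℝ) : ℂ) * x j‖ ≤ h * (2 * (d + 2 + (1 + T)) * (d * (B * R))) := by
    have e : ‖(h : ℂ) ^ 2 * (2 - d) + h * convFactor h ε x‖ ≤ h * (d + 2 + (1 + T)) := by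
      refine (norm_add_le _ _).trans ?_
      rw [norm_mul, norm_mul, norm_pow, hnh, mul_add]
      gcongr
    rw [norm_mul, norm_mul, norm_mul, Complex.norm_I, Complex.norm_ofNat, mul_one]
    calc _ ≤ 2 * (h * (d + 2 + (1 + T))) * (d * (B * R)) := by gcongr
      _ = _ := by ring
  have t6 : ‖(h : ℂ) ^ 2 * (2 - d) * ∑ j, (x j : ℂ) * (starRingEnd ℂ) (pd j p x)‖ ≤
      h * ((d + 2) * (h * (‖x‖ * ∑ j, ‖pd j p x‖))) := by
    rw [norm_mul, norm_mul, norm_pow, hnh]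
    calc _ ≤ h ^ 2 * (d + 2) * (‖x‖ * ∑ j, ‖pd j p x‖) := by gcongr
      _ = _ := by ring
  have t7 : ‖2 * Complex.I * (h : ℂ) ^ 2 * ‖x‖ ^ 2 *
      ∑ j, ((W x j : ℝ) : ℂ) * (starRingEnd ℂ) (pd j p x)‖ ≤
      h * (2 * (B * R) * (h * (‖x‖ * ∑ j, ‖pd j p x‖))) := by
    rw [norm_mul, norm_mul, norm_mul, norm_mul, norm_pow, norm_pow, hnh, hnr, Complex.norm_I,
      Complex.norm_ofNat, mul_one]
    calc _ ≤ 2 * h ^ 2 * (‖x‖ * R) * (B * ∑ j, ‖pd j p x‖) := by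
          rw [sq ‖x‖]
          have : 0 ≤ ∑ j, ‖pd j p x‖ := Finset.sum_nonneg fun j _ => norm_nonneg _
          gcongr
      _ = _ := by ring
  rw [weakRemainder, norm_mul, mul_assoc ‖w x‖]
  refine mul_le_mul_of_nonneg_left ((norm_mul_sub_add_le _ _ _ _ _ _ _ _).trans ?_) (norm_nonneg _)
  rw [RCLike.norm_conj]
  have := mul_le_mul_of_nonneg_left
    (add_le_add (add_le_add (add_le_add (add_le_add t1 t2) t3) t4) t5) (norm_nonneg (p x))
  linarith

lemma exists_weakRemainder_le {ρ R : ℝ} (hρ : 0 < ρ) {W : Euc d → Euc d} (hW : ContDiff ℝ 2 W)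
    {q : Euc d → ℂ} {M : ℝ} (hM : ∀ x, ‖q x‖ ≤ M) : ∃ C : ℝ, 0 < C ∧ ∀ ε h : ℝ, 0 < ε → 0 < h →
      h ≤ 1 → h ≤ ε → h ≤ ε ^ 2 → ∀ (w p : Euc d → ℂ), ∀ x ∈ annulus d ρ R,
        ‖weakRemainder h ε W q w p x‖ ≤ C * h ^ 2 * ‖w x‖ ^ 2 + energyDensity h p p x / 8 := by
  obtain ⟨B, hB⟩ := (isCompact_closedBall (0 : Euc d) R).exists_bound_of_continuousOn
    hW.continuous.continuousOn
  have hdiv : Continuous fun x => ∑ j, pd j (fun y => W y j) x :=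
    continuous_finsetSum _ fun j _ =>
      ((contDiff_coord hW j).continuous_fderiv (by norm_num)).clm_apply continuous_const
  obtain ⟨D, hD⟩ := (isCompact_closedBall (0 : Euc d) R).exists_bound_of_continuousOn
    hdiv.continuousOn
  set T := |Real.log ρ| + |Real.log R|
  set K := T ^ 2 + 1 + (1 + T) * (d + 2) + R ^ 2 * (D + B ^ 2 + M) +
        2 * (d + 2 + (1 + T)) * (d * (B * R))
  set L := d + 2 + 2 * (B * R)
  refine ⟨2 * K ^ 2 + 2 * (d + 1) * L ^ 2 + 1, by positivity, ?_⟩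
  intro ε h hε hh h1 h2 h3 w p x hx
  have hxR : x ∈ Metric.closedBall (0 : Euc d) R := by simpa using hx.2.le
  refine (norm_weakRemainder_le hε hh h1 h2 h3 W q w p (abs_carlWeight_le hρ hx) hx.2.le
    (hB x hxR) (hD x hxR) (hM x)).trans ?_
  have hS : (∑ j, ‖pd j p x‖) ^ 2 ≤ (d + 1) * ∑ j, ‖pd j p x‖ ^ 2 := by
    have e := sq_sum_le_card_mul_sum_sq (s := Finset.univ) (f := fun j => ‖pd j p x‖)
    have e' : 0 ≤ ∑ j, ‖pd j p x‖ ^ 2 := Finset.sum_nonneg fun j _ => sq_nonneg _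
    simp only [Finset.card_univ, Fintype.card_fin] at e
    linarith
  rw [energyDensity_self]
  have y1 : ‖w x‖ * h * (K * ‖p x‖) ≤ 2 * K ^ 2 * (h ^ 2 * ‖w x‖ ^ 2) + ‖p x‖ ^ 2 / 8 := by
    nlinarith [sq_nonneg (4 * (‖w x‖ * h * K) - ‖p x‖)]
  have y2 : ‖w x‖ * h * (L * (h * (‖x‖ * ∑ j, ‖pd j p x‖))) ≤
      2 * (d + 1) * L ^ 2 * (h ^ 2 * ‖w x‖ ^ 2) +
        h ^ 2 * (‖x‖ ^ 2 * ∑ j, ‖pd j p x‖ ^ 2) / 8 := by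
    set S := ∑ j, ‖pd j p x‖
    set S2 := ∑ j, ‖pd j p x‖ ^ 2
    have e1 : (h * ‖x‖ * S) ^ 2 ≤ (d + 1) * (h ^ 2 * (‖x‖ ^ 2 * S2)) := by
      calc _ = (h * ‖x‖) ^ 2 * S ^ 2 := by ring
        _ ≤ (h * ‖x‖) ^ 2 * ((d + 1) * S2) := by gcongr
        _ = _ := by ring
    have e2 : ‖w x‖ * h * (L * (h * (‖x‖ * S))) ≤
        2 * (d + 1) * L ^ 2 * (h ^ 2 * ‖w x‖ ^ 2) + (h * ‖x‖ * S) ^ 2 / (8 * (d + 1)) := by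
      have e3 : 2 * (d + 1) * L ^ 2 * (h ^ 2 * ‖w x‖ ^ 2) + (h * ‖x‖ * S) ^ 2 / (8 * (d + 1)) -
          ‖w x‖ * h * (L * (h * (‖x‖ * S))) =
          (4 * (d + 1) * L * h * ‖w x‖ - h * ‖x‖ * S) ^ 2 / (8 * (d + 1)) := by
        field_simp
        ring
      have e4 : 0 ≤ (4 * (d + 1) * L * h * ‖w x‖ - h * ‖x‖ * S) ^ 2 / (8 * (d + 1)) := by
        positivity
      linarith
    have e5 : (h * ‖x‖ * S) ^ 2 / (8 * (d + 1)) ≤ h ^ 2 * (‖x‖ ^ 2 * S2) / 8 := by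
      rw [div_le_div_iff₀ (by positivity) (by positivity)]
      linarith
    linarith
  have y3 : 0 ≤ h ^ 2 * ‖w x‖ ^ 2 := by positivity
  rw [mul_add]
  linarith

end Remainder

section Cutoff

variable {d : ℕ}

lemma exists_cutoff {ρ R : ℝ} (hρ : 0 < ρ) (hR : 0 < R) : ∃ σ : Euc d → ℂ, IsTest (Punct d) σ ∧
    ∀ x ∈ annulus d ρ R, σ x = ((‖x‖ ^ 2 * dilWeight x : ℝ) : ℂ) := by
  let f : ContDiffBump (0 : Euc d) := ⟨R, R + 1, hR, by linarith⟩
  let g : ContDiffBump (0 : Euc d) := ⟨ρ / 2, ρ, by linarith, by linarith⟩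
  have hχ : IsTest (Punct d) fun x => ((f x * (1 - g x) : ℝ) : ℂ) := by
    refine ⟨Complex.ofRealCLM.contDiff.comp
      (f.contDiff.mul (contDiff_const.sub g.contDiff)), ?_, ?_⟩
    · refine HasCompactSupport.intro f.hasCompactSupport fun x hx => ?_
      simp [image_eq_zero_of_notMem_tsupport hx]
    · have h1 : tsupport (fun x => ((f x * (1 - g x) : ℝ) : ℂ)) ⊆ {x | ρ / 2 ≤ ‖x‖} := by
        refine closure_minimal (fun x hx => ?_) (isClosed_le continuous_const continuous_norm)
        by_contra h
        refine hx ?_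
        have : g x = 1 := g.one_of_mem_closedBall (by simpa using (not_le.1 h).le)
        simp [this]
      intro x hx
      have := h1 hx
      exact norm_pos_iff.1 (lt_of_lt_of_le (by linarith) this)
  refine ⟨_, hχ.mul_left subset_rfl (g := fun x => ((‖x‖ ^ 2 * dilWeight x : ℝ) : ℂ))
    fun x hx => Complex.ofRealCLM.contDiff.contDiffAt.comp x
      ((contDiff_norm_sq ℝ).contDiffAt.mul (dilWeight_contDiffAt hx)), fun x hx => ?_⟩
  have h1 : f x = 1 := f.one_of_mem_closedBall (by simpa using hx.2.le)
  have h2 : g x = 0 := g.zero_of_le_dist (by simpa using hx.1.le)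
  simp [h1, h2]

lemma exists_H1norm_mul_sq_le {σ : Euc d → ℂ} (hσ : IsTest (Punct d) σ) : ∃ C : ℝ, 0 < C ∧
    ∀ h : ℝ, 0 < h → h ≤ 1 → ∀ U ⊆ Punct d, ∀ p, IsTest U p →
      H1norm h U (fun x => σ x * p x) ^ 2 ≤ C * energy h p p := by
  have hinv : ContinuousOn (fun x : Euc d => (dilWeight x)⁻¹) (Punct d) :=
    dilWeight_continuousOn.inv₀ fun x _ => (dilWeight_pos x).ne'
  have hinv2 : ContinuousOn (fun x : Euc d => (‖x‖ ^ 2)⁻¹) (Punct d) :=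
    (continuous_norm.pow 2).continuousOn.inv₀ fun x hx => pow_ne_zero 2 (norm_ne_zero_iff.2 hx)
  have c1 : Continuous fun x => ‖σ x‖ ^ 2 + 2 * ∑ j, ‖pd j σ x‖ ^ 2 :=
    (hσ.1.continuous.norm.pow 2).add (continuous_const.mul (continuous_finsetSum _ fun j _ =>
      (hσ.partialDeriv j).1.continuous.norm.pow 2))
  have c2 : Continuous fun x => 2 * ‖σ x‖ ^ 2 :=
    continuous_const.mul (hσ.1.continuous.norm.pow 2)
  obtain ⟨C1, hC1⟩ := hσ.2.1.isCompact.exists_bound_of_continuousOn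
    ((c1.continuousOn.mul hinv).mono hσ.2.2)
  obtain ⟨C2, hC2⟩ := hσ.2.1.isCompact.exists_bound_of_continuousOn
    ((c2.continuousOn.mul (hinv.mul hinv2)).mono hσ.2.2)
  refine ⟨max (max C1 C2) 1, by positivity, fun h hh h1 U hU p hp => ?_⟩
  set C := max (max C1 C2) 1
  have hp' := hp.mono hU
  have hψ : IsTest (Punct d) fun x => σ x * p x :=
    hp'.mul_left subset_rfl fun x _ => hσ.1.contDiffAt
  have hpt : ∀ x, ‖σ x * p x‖ ^ 2 + h ^ 2 * ∑ j, ‖pd j (fun x => σ x * p x) x‖ ^ 2 ≤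
      C * (dilWeight x * energyDensity h p p x) := by
    intro x
    have hm := dilWeight_pos x
    by_cases hx : x ∈ tsupport σ
    · have hr : 0 < ‖x‖ := norm_pos_iff.2 (hσ.2.2 hx)
      have b1 : ‖σ x‖ ^ 2 + 2 * ∑ j, ‖pd j σ x‖ ^ 2 ≤ C * dilWeight x := by
        have : (‖σ x‖ ^ 2 + 2 * ∑ j, ‖pd j σ x‖ ^ 2) * (dilWeight x)⁻¹ ≤ C :=
          (le_abs_self _).trans ((hC1 x hx).trans
          ((le_max_left C1 C2).trans (le_max_left _ 1)))
        rwa [← div_eq_mul_inv, div_le_iff₀ hm] at this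
      have b2 : 2 * ‖σ x‖ ^ 2 ≤ C * (dilWeight x * ‖x‖ ^ 2) := by
        have : 2 * ‖σ x‖ ^ 2 * ((dilWeight x)⁻¹ * (‖x‖ ^ 2)⁻¹) ≤ C :=
          (le_abs_self _).trans ((hC2 x hx).trans
          ((le_max_right C1 C2).trans (le_max_left _ 1)))
        rwa [← mul_inv, ← div_eq_mul_inv, div_le_iff₀ (by positivity)] at this
      have b3 : ∑ j, ‖pd j (fun x => σ x * p x) x‖ ^ 2 ≤
          2 * (∑ j, ‖pd j σ x‖ ^ 2) * ‖p x‖ ^ 2 + 2 * ‖σ x‖ ^ 2 * ∑ j, ‖pd j p x‖ ^ 2 := by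
        rw [Finset.mul_sum, Finset.mul_sum, Finset.sum_mul, ← Finset.sum_add_distrib]
        refine Finset.sum_le_sum fun j _ => ?_
        rw [pd_mul j (hσ.differentiable x) (hp.differentiable x)]
        have e1 := norm_add_le (pd j σ x * p x) (σ x * pd j p x)
        rw [norm_mul, norm_mul] at e1
        have e2 := pow_le_pow_left₀ (norm_nonneg _) e1 2
        nlinarith [sq_nonneg (‖pd j σ x‖ * ‖p x‖ - ‖σ x‖ * ‖pd j p x‖)]
      rw [energyDensity_self, norm_mul]
      have n1 : 0 ≤ ∑ j, ‖pd j σ x‖ ^ 2 := Finset.sum_nonneg fun j _ => sq_nonneg _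
      have n2 : 0 ≤ ∑ j, ‖pd j p x‖ ^ 2 := Finset.sum_nonneg fun j _ => sq_nonneg _
      have hh2 : h ^ 2 ≤ 1 := by nlinarith
      calc _ ≤ (‖σ x‖ * ‖p x‖) ^ 2 + h ^ 2 * (2 * (∑ j, ‖pd j σ x‖ ^ 2) * ‖p x‖ ^ 2 +
            2 * ‖σ x‖ ^ 2 * ∑ j, ‖pd j p x‖ ^ 2) := by gcongr
        _ = (‖σ x‖ ^ 2 + h ^ 2 * (2 * ∑ j, ‖pd j σ x‖ ^ 2)) * ‖p x‖ ^ 2 +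
            2 * ‖σ x‖ ^ 2 * (h ^ 2 * ∑ j, ‖pd j p x‖ ^ 2) := by ring
        _ ≤ (‖σ x‖ ^ 2 + 1 * (2 * ∑ j, ‖pd j σ x‖ ^ 2)) * ‖p x‖ ^ 2 +
            2 * ‖σ x‖ ^ 2 * (h ^ 2 * ∑ j, ‖pd j p x‖ ^ 2) := by gcongr
        _ ≤ C * dilWeight x * ‖p x‖ ^ 2 +
            C * (dilWeight x * ‖x‖ ^ 2) * (h ^ 2 * ∑ j, ‖pd j p x‖ ^ 2) := by
            rw [one_mul]; gcongr
        _ = _ := by ring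
    · have h0 : x ∉ tsupport fun x => σ x * p x := fun h => hx (tsupport_mul_subset_left h)
      have h2 : σ x * p x = 0 := by
        rw [image_eq_zero_of_notMem_tsupport hx, zero_mul]
      simp only [h2, pd_eq_zero _ h0]
      have : 0 ≤ energyDensity h p p x := by rw [energyDensity_self]; positivity
      simp
      positivity
  have i1 : Integrable fun x => ‖σ x * p x‖ ^ 2 :=
    hψ.integrable (hψ.1.continuous.norm.pow 2).continuousOn
      fun x hx => by simp [image_eq_zero_of_notMem_tsupport (f := fun x => σ x * p x) hx]
  have i2 : Integrable fun x => ∑ j, ‖pd j (fun x => σ x * p x) x‖ ^ 2 :=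
    hψ.integrable (continuous_finsetSum _ fun j _ =>
      (hψ.partialDeriv j).1.continuous.norm.pow 2).continuousOn
      fun x hx => by simp [pd_eq_zero _ hx]
  have n1 : 0 ≤ ∫ x in U, ‖σ x * p x‖ ^ 2 := integral_nonneg fun x => by positivity
  have n2 : 0 ≤ ∫ x in U, ∑ j, ‖pd j (fun x => σ x * p x) x‖ ^ 2 :=
    integral_nonneg fun x => by positivity
  rw [H1norm, Real.sq_sqrt (by positivity), energy]
  have l1 : ∫ x in U, ‖σ x * p x‖ ^ 2 ≤ ∫ x, ‖σ x * p x‖ ^ 2 :=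
    setIntegral_le_integral i1 (Filter.Eventually.of_forall fun x => by positivity)
  have l2 : ∫ x in U, ∑ j, ‖pd j (fun x => σ x * p x) x‖ ^ 2 ≤
      ∫ x, ∑ j, ‖pd j (fun x => σ x * p x) x‖ ^ 2 :=
    setIntegral_le_integral i2 (Filter.Eventually.of_forall fun x => by positivity)
  calc _ ≤ (∫ x, ‖σ x * p x‖ ^ 2) + h ^ 2 * ∫ x, ∑ j, ‖pd j (fun x => σ x * p x) x‖ ^ 2 := by
        gcongr
    _ = ∫ x, (‖σ x * p x‖ ^ 2 + h ^ 2 * ∑ j, ‖pd j (fun x => σ x * p x) x‖ ^ 2) := by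
        rw [integral_add i1 (i2.const_mul _), integral_const_mul]
    _ ≤ ∫ x, C * (dilWeight x * energyDensity h p p x) :=
        integral_mono (i1.add (i2.const_mul _))
          ((hp'.integrable_energyDensity h hp').const_mul C) hpt
    _ = _ := integral_const_mul _ _

end Cutoff

section CarlemanEstimate

variable {d : ℕ}

lemma integral_dilWeight_mul_eulerDeriv [Nontrivial (Euc d)] {g : Euc d → ℂ}
    (hg : IsTest (Punct d) g) : ∫ x, dilWeight x * (eulerDeriv g x).re = 0 := by
  have hF : ∀ j, IsTest (Punct d) fun x : Euc d => ((x j * dilWeight x : ℝ) : ℂ) * g x := fun j =>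
    hg.mul_left Subset.rfl fun x hx => Complex.ofRealCLM.contDiff.contDiffAt.comp x
      ((contDiff_coord contDiff_id j).contDiffAt.mul (dilWeight_contDiffAt hx))
  have hi : ∀ j, Integrable (pd j fun x : Euc d => ((x j * dilWeight x : ℝ) : ℂ) * g x) :=
    fun j => ((hF j).partialDeriv j).1.continuous.integrable_of_hasCompactSupport
      ((hF j).partialDeriv j).2.1
  have h0 : ∫ x, ∑ j, pd j (fun x : Euc d => ((x j * dilWeight x : ℝ) : ℂ) * g x) x = 0 := by
    rw [integral_finsetSum _ fun j _ => hi j]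
    exact Finset.sum_eq_zero fun j _ => hg.integral_pd_eq_zero
      ((hF j).1.contDiffOn.of_le (by exact_mod_cast le_top))
      (fun x hx => by simp [image_eq_zero_of_notMem_tsupport hx]) j
  have h1 : ∫ x, (dilWeight x : ℂ) * eulerDeriv g x = 0 := by
    rw [← h0]
    refine integral_congr_ae ?_
    filter_upwards [ae_ne_zero] with x hx
    have hm : DifferentiableAt ℝ (dilWeight (d := d)) x :=
      (dilWeight_contDiffAt (k := 1) hx).differentiableAt (by simp)
    have hc : ∀ j, DifferentiableAt ℝ (fun y : Euc d => y j) x := fun j =>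
      ((contDiff_coord (k := 1) contDiff_id j).differentiable (by simp)) x
    have hx' : (‖x‖ : ℂ) ^ 2 ≠ 0 := by
      exact_mod_cast pow_ne_zero 2 (norm_ne_zero_iff.2 hx)
    have hs : ∑ j, (x j : ℂ) ^ 2 = (‖x‖ : ℂ) ^ 2 := by exact_mod_cast sum_coord_sq x
    have e : ∀ j, pd j (fun x : Euc d => ((x j * dilWeight x : ℝ) : ℂ) * g x) x =
        dilWeight x * g x - d * dilWeight x * g x / (‖x‖ : ℂ) ^ 2 * (x j : ℂ) ^ 2 +
          dilWeight x * ((x j : ℂ) * pd j g x) := by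
      intro j
      have hcm : DifferentiableAt ℝ (fun y : Euc d => y j * dilWeight y) x := (hc j).mul hm
      rw [pd_mul j (differentiableAt_ofReal hcm) (hg.differentiable x), pd_ofReal j hcm,
        pd_mul j (hc j) hm, pd_dilWeight j hx, pd_coord]
      simp only [if_true]
      push_cast
      ring
    simp only [e, Finset.sum_add_distrib, Finset.sum_sub_distrib, ← Finset.mul_sum, hs,
      eulerDeriv_eq_sum]
    rw [div_mul_cancel₀ _ hx']
    simp
    ring
  have h2 : Integrable fun x => (dilWeight x : ℂ) * eulerDeriv g x :=
    hg.eulerDeriv.integrable ((Complex.continuous_ofReal.comp_continuousOn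
      dilWeight_continuousOn).mul hg.eulerDeriv.1.continuous.continuousOn)
      fun x hx => by simp [image_eq_zero_of_notMem_tsupport hx]
  have h3 := congrArg Complex.re h1
  rw [← RCLike.re_eq_complex_re, ← integral_re h2] at h3
  simpa using h3

lemma weakIntegrand_congr (h ε : ℝ) (W : Euc d → Euc d) (q w : Euc d → ℂ) {ψ₁ ψ₂ : Euc d → ℂ}
    {x : Euc d} (hψ : ψ₁ =ᶠ[nhds x] ψ₂) :
    weakIntegrand h ε W q w ψ₁ x = weakIntegrand h ε W q w ψ₂ x := by
  simp only [weakIntegrand, pd, hψ.fderiv_eq, hψ.eq_of_nhds]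

lemma weakIntegrand_eq_zero (h ε : ℝ) (W : Euc d → Euc d) (q ψ : Euc d → ℂ) {w : Euc d → ℂ}
    {x : Euc d} (hx : x ∉ tsupport w) : weakIntegrand h ε W q w ψ x = 0 := by
  simp [weakIntegrand, image_eq_zero_of_notMem_tsupport hx, pd_eq_zero _ hx]

lemma eulerDeriv_eq_zero {u : Euc d → ℂ} {x : Euc d} (hx : x ∉ tsupport u) :
    eulerDeriv u x = 0 := by
  simp [eulerDeriv_eq_sum, pd_eq_zero _ hx]

lemma integral_re_weakIntegrand_ge [Nontrivial (Euc d)] {h ε C ρ R : ℝ} (hh : 0 < h) (hε : 0 < ε)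
    (hρ : 0 < ρ) {W : Euc d → Euc d} (hW : ContDiff ℝ 2 W) {q : Euc d → ℂ} (hq : Measurable q)
    {M : ℝ} (hM : ∀ x, ‖q x‖ ≤ M) {σ w p : Euc d → ℂ} (hσ : IsTest (Punct d) σ)
    (hσμ : ∀ x ∈ annulus d ρ R, σ x = ((‖x‖ ^ 2 * dilWeight x : ℝ) : ℂ))
    (hrem : ∀ x ∈ annulus d ρ R,
      ‖weakRemainder h ε W q w p x‖ ≤ C * h ^ 2 * ‖w x‖ ^ 2 + energyDensity h p p x / 8)
    (hw : IsTest (annulus d ρ R) w) (hp : IsTest (Punct d) p) :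
    energy h w p - pairing (fun y => 2 * (convFactor h ε y : ℂ) * w y) p +
        h * pairing (eulerDeriv fun y => 2 * (convFactor h ε y : ℂ) * w y) p -
        C * h ^ 2 * pairing w w - energy h p p / 8 ≤
      (∫ x, weakIntegrand h ε W q w (fun y => σ y * p y) x).re := by
  have hA : annulus d ρ R ⊆ Punct d := annulus_subset_punct hρ.le
  have hw' : IsTest (Punct d) w := hw.mono hA
  have hconv : ∀ x : Euc d, x ≠ 0 → ContDiffAt ℝ (⊤ : ℕ∞) (fun y => (convFactor h ε y : ℂ)) x :=
    fun x hx => Complex.ofRealCLM.contDiff.contDiffAt.comp x (convFactor_contDiffAt h ε hx)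
  set z : Euc d → ℂ := fun y => 2 * (convFactor h ε y : ℂ) * w y
  set g : Euc d → ℂ := fun y => (h ^ 2 * (2 - d) - h * (convFactor h ε y : ℂ)) *
    (w y * (starRingEnd ℂ) (p y)) with hg_def
  have hz : IsTest (Punct d) z := hw'.mul_left Subset.rfl fun x hx =>
    contDiffAt_const.mul (hconv x hx)
  have hg' : g = fun y => ((h ^ 2 * (2 - d) - h * (convFactor h ε y : ℂ)) *
      (starRingEnd ℂ) (p y)) * w y := by
    ext y
    simp only [hg_def]
    ring
  have hg : IsTest (Punct d) g := by
    rw [hg']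
    exact hw'.mul_left Subset.rfl fun x hx =>
      (contDiffAt_const.sub (contDiffAt_const.mul (hconv x hx))).mul
        (contDiff_conj hp.1).contDiffAt
  have tz : tsupport z ⊆ tsupport w := tsupport_mul_subset_right
  have tg : tsupport g ⊆ tsupport w := by
    rw [hg']
    exact tsupport_mul_subset_right
  have i₁ := hw'.integrable_energyDensity h hp
  have i₂ := hp.integrable_pairing hz.1.continuous
  have i₃ := hp.integrable_pairing hz.eulerDeriv.1.continuous
  have i₄ := hw'.integrable_pairing hw'.1.continuous
  have i₅ := hp.integrable_energyDensity h hp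
  have i₆ : Integrable fun x => dilWeight x * (eulerDeriv g x).re :=
    hg.eulerDeriv.integrable (dilWeight_continuousOn.mul
      (Complex.continuous_re.comp hg.eulerDeriv.1.continuous).continuousOn)
      fun x hx => by simp [image_eq_zero_of_notMem_tsupport hx]
  have i₀ := weakIntegrand_integrable h ε hW hq hM hw'
    (hp.mul_left Subset.rfl fun x _ => hσ.1.contDiffAt)
  have key : ∀ x, dilWeight x * energyDensity h w p x -
      dilWeight x * (z x * (starRingEnd ℂ) (p x)).re +
      h * (dilWeight x * (eulerDeriv z x * (starRingEnd ℂ) (p x)).re) -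
      C * h ^ 2 * (dilWeight x * (w x * (starRingEnd ℂ) (w x)).re) -
      dilWeight x * energyDensity h p p x / 8 + dilWeight x * (eulerDeriv g x).re ≤
      (weakIntegrand h ε W q w (fun y => σ y * p y) x).re := by
    intro x
    have hm := dilWeight_pos x
    have hE : 0 ≤ energyDensity h p p x := by
      rw [energyDensity_self]
      positivity
    by_cases hx : x ∈ tsupport w
    · have hxA := hw.2.2 hx
      have hnhds : (fun y => σ y * p y) =ᶠ[nhds x]
          fun y => ((‖y‖ ^ 2 * dilWeight y : ℝ) : ℂ) * p y := by
        have hopen : IsOpen (annulus d ρ R) :=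
          (isOpen_lt continuous_const continuous_norm).inter
            (isOpen_lt continuous_norm continuous_const)
        filter_upwards [hopen.mem_nhds hxA] with y hy
        rw [hσμ y hy]
      rw [weakIntegrand_congr h ε W q w hnhds, weakIntegrand_eq hh.ne' hε.ne' W q (hA hxA)
        (hw'.differentiable x) (hp.differentiable x), Complex.re_ofReal_mul]
      have hr := (abs_le.1 ((Complex.abs_re_le_norm _).trans (hrem x hxA))).1
      have e1 : (w x * (starRingEnd ℂ) (p x) +
          h ^ 2 * (‖x‖ ^ 2 * ∑ j, pd j w x * (starRingEnd ℂ) (pd j p x))).re =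
          energyDensity h w p x := by
        rw [energyDensity, Complex.add_re, ← Complex.ofReal_pow, ← Complex.ofReal_pow,
          Complex.re_ofReal_mul, Complex.re_ofReal_mul, Complex.re_sum]
      have e2 : (h * (eulerDeriv z x * (starRingEnd ℂ) (p x)) : ℂ).re =
          h * (eulerDeriv z x * (starRingEnd ℂ) (p x)).re := Complex.re_ofReal_mul _ _
      rw [Complex.add_re, Complex.add_re, Complex.add_re, Complex.sub_re, e1, e2,
        re_mul_conj_self]
      nlinarith [mul_le_mul_of_nonneg_left hr hm.le]
    · rw [weakIntegrand_eq_zero h ε W q _ hx, eulerDeriv_eq_zero fun hx' => hx (tz hx'),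
        eulerDeriv_eq_zero fun hx' => hx (tg hx'),
        image_eq_zero_of_notMem_tsupport fun hx' => hx (tz hx'),
        image_eq_zero_of_notMem_tsupport hx]
      have e1 : energyDensity h w p x = 0 := by
        simp [energyDensity, image_eq_zero_of_notMem_tsupport hx, pd_eq_zero _ hx]
      simp only [e1, zero_mul, Complex.zero_re, mul_zero]
      have := mul_nonneg hm.le hE
      linarith
  have j₁ : Integrable fun x => dilWeight x * energyDensity h w p x -
      dilWeight x * (z x * (starRingEnd ℂ) (p x)).re := i₁.sub i₂
  have j₂ : Integrable fun x => dilWeight x * energyDensity h w p x -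
      dilWeight x * (z x * (starRingEnd ℂ) (p x)).re +
      h * (dilWeight x * (eulerDeriv z x * (starRingEnd ℂ) (p x)).re) := j₁.add (i₃.const_mul h)
  have j₃ : Integrable fun x => dilWeight x * energyDensity h w p x -
      dilWeight x * (z x * (starRingEnd ℂ) (p x)).re +
      h * (dilWeight x * (eulerDeriv z x * (starRingEnd ℂ) (p x)).re) -
      C * h ^ 2 * (dilWeight x * (w x * (starRingEnd ℂ) (w x)).re) :=
    j₂.sub (i₄.const_mul (C * h ^ 2))
  have j₄ : Integrable fun x => dilWeight x * energyDensity h w p x -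
      dilWeight x * (z x * (starRingEnd ℂ) (p x)).re +
      h * (dilWeight x * (eulerDeriv z x * (starRingEnd ℂ) (p x)).re) -
      C * h ^ 2 * (dilWeight x * (w x * (starRingEnd ℂ) (w x)).re) -
      dilWeight x * energyDensity h p p x / 8 := j₃.sub (i₅.div_const 8)
  have hle := integral_mono (j₄.add i₆) i₀.re key
  rw [integral_add' j₄ i₆, integral_sub j₃ (i₅.div_const 8), integral_sub j₂ (i₄.const_mul _),
    integral_add j₁ (i₃.const_mul h), integral_sub i₁ i₂, integral_const_mul, integral_const_mul,
    integral_div, integral_dilWeight_mul_eulerDeriv hg, add_zero, integral_re i₀] at hle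
  exact hle

lemma energy_eq_sub_add (h : ℝ) {w v p : Euc d → ℂ} (hw : IsTest (Punct d) w)
    (hv : IsTest (Punct d) v) (hp : IsTest (Punct d) p) :
    energy h w p = energy h (fun y => w y - v y) p + energy h v p := by
  simp only [energy]
  rw [← integral_add ((hw.sub hv).integrable_energyDensity h hp)
    (hv.integrable_energyDensity h hp)]
  congr 1
  ext x
  simp only [energyDensity, pd_sub _ (hw.differentiable x) (hv.differentiable x), sub_mul,
    Complex.sub_re, Finset.sum_sub_distrib]
  ring

lemma pairing_sub {z w v : Euc d → ℂ} (hz : IsTest (Punct d) z) (hw : IsTest (Punct d) w)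
    (hv : IsTest (Punct d) v) :
    pairing z (fun y => w y - v y) = pairing z w - pairing z v := by
  simp only [pairing]
  rw [← integral_sub (hw.integrable_pairing hz.1.continuous)
    (hv.integrable_pairing hz.1.continuous)]
  congr 1
  ext x
  simp only [map_sub, mul_sub, Complex.sub_re]

lemma pairing_eulerDeriv_self [Nontrivial (Euc d)] (h ε : ℝ) {w : Euc d → ℂ}
    (hw : IsTest (Punct d) w) :
    pairing (eulerDeriv fun y => 2 * (convFactor h ε y : ℂ) * w y) w =
      h / ε * pairing w w := by
  have hconv : ∀ x : Euc d, x ≠ 0 → ContDiffAt ℝ (⊤ : ℕ∞) (fun y => (convFactor h ε y : ℂ)) x :=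
    fun x hx => Complex.ofRealCLM.contDiff.contDiffAt.comp x (convFactor_contDiffAt h ε hx)
  have hg : IsTest (Punct d) fun y =>
      ((convFactor h ε y : ℂ) * (starRingEnd ℂ) (w y)) * w y :=
    hw.mul_left Subset.rfl fun x hx => (hconv x hx).mul (contDiff_conj hw.1).contDiffAt
  have i₁ := hw.integrable_pairing hw.1.continuous
  have i₂ : Integrable fun x => dilWeight x * (eulerDeriv (fun y =>
      ((convFactor h ε y : ℂ) * (starRingEnd ℂ) (w y)) * w y) x).re :=
    hg.eulerDeriv.integrable (dilWeight_continuousOn.mul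
      (Complex.continuous_re.comp hg.eulerDeriv.1.continuous).continuousOn)
      fun x hx => by simp [image_eq_zero_of_notMem_tsupport hx]
  rw [← add_zero (h / ε * pairing w w), ← integral_dilWeight_mul_eulerDeriv hg, pairing, pairing,
    ← integral_const_mul, ← integral_add (i₁.const_mul _) i₂]
  refine integral_congr_ae ?_
  filter_upwards [ae_ne_zero] with x hx
  have ha := (hconv x hx).differentiableAt (by simp)
  have hwx := hw.differentiable x
  have hcw : DifferentiableAt ℝ (fun y => (starRingEnd ℂ) (w y)) x := differentiableAt_conj hwx
  have hacw : DifferentiableAt ℝ (fun y => (convFactor h ε y : ℂ) * (starRingEnd ℂ) (w y)) x :=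
    ha.mul hcw
  have hconst : eulerDeriv (fun _ : Euc d => (2 : ℂ)) x = 0 := by simp [eulerDeriv]
  rw [eulerDeriv_mul (ha.const_mul _) hwx, eulerDeriv_mul (differentiableAt_const _) ha, hconst,
    eulerDeriv_mul hacw hwx, eulerDeriv_mul ha hcw, eulerDeriv_conj hwx,
    eulerDeriv_convFactor h ε hx]
  simp only [Complex.mul_re, Complex.mul_im, Complex.add_re, Complex.add_im, Complex.ofReal_re,
    Complex.ofReal_im, Complex.conj_re, Complex.conj_im, Complex.re_ofNat, Complex.im_ofNat,
    Complex.zero_re, Complex.zero_im]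
  ring

lemma exists_test_energy_le [Nontrivial (Euc d)] {U : Set (Euc d)} (hU : U ⊆ Punct d)
    (hUs : ∀ x ∈ U, ∀ c : ℝ, 1 ≤ c → c • x ∈ U) {h ε C ρ R η : ℝ} (hh : 0 < h) (hε : 0 < ε)
    (hρ : 0 < ρ) {W : Euc d → Euc d} (hW : ContDiff ℝ 2 W) {q : Euc d → ℂ} (hq : Measurable q)
    {M : ℝ} (hM : ∀ x, ‖q x‖ ≤ M) {σ w : Euc d → ℂ} (hσ : IsTest (Punct d) σ)
    (hσμ : ∀ x ∈ annulus d ρ R, σ x = ((‖x‖ ^ 2 * dilWeight x : ℝ) : ℂ))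
    (hrem : ∀ p, ∀ x ∈ annulus d ρ R,
      ‖weakRemainder h ε W q w p x‖ ≤ C * h ^ 2 * ‖w x‖ ^ 2 + energyDensity h p p x / 8)
    (hw : IsTest (annulus d ρ R) w) (hwU : IsTest U w) (hη : 0 < η) :
    ∃ p, IsTest U p ∧
      3 / 4 * energy h p p + (h ^ 2 / ε - C * h ^ 2) * pairing w w ≤
        ‖∫ x, conjOpEps h ε W q w x * (starRingEnd ℂ) (σ x * p x)‖ + (1 + h) * η := by
  have hw' : IsTest (Punct d) w := hwU.mono hU
  have hz : ∀ {V : Set (Euc d)}, V ⊆ Punct d → IsTest V w →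
      IsTest V fun y => 2 * (convFactor h ε y : ℂ) * w y := fun hV hwV =>
    hwV.mul_left hV fun x hx => contDiffAt_const.mul
      (Complex.ofRealCLM.contDiff.contDiffAt.comp x (convFactor_contDiffAt h ε hx))
  obtain ⟨v, hv, hv₁, hv₂⟩ := exists_approximate_solution h hU hUs hρ
    (hz (annulus_subset_punct hρ.le) hw) hη
  have hp := hwU.sub hv
  have hv' := hv.mono hU
  have hp' := hp.mono hU
  refine ⟨_, hp, ?_⟩
  have h₁ := integral_re_weakIntegrand_ge hh hε hρ hW hq hM hσ hσμ (hrem _) hw hp'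
  have h₂ := hv₁ _ hp
  rw [← integral_conjOpEps_mul_conj h ε hW hq hM hw'
    (hp'.mul_left Subset.rfl fun x _ => hσ.1.contDiffAt), energy_eq_sub_add h hw' hv' hp',
    pairing_sub (hz Subset.rfl hw').eulerDeriv hw' hv', pairing_eulerDeriv_self h ε hw'] at h₁
  have h₃ := h₁.trans (Complex.re_le_norm _)
  have h₄ := mul_le_mul_of_nonneg_left hv₂ hh.le
  have h₅ : h * (h / ε * pairing w w) = h ^ 2 / ε * pairing w w := by ring
  linarith

lemma pairing_self_le_sq_Hneg1norm [Nontrivial (Euc d)] {U : Set (Euc d)} (hU : U ⊆ Punct d)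
    (hUs : ∀ x ∈ U, ∀ c : ℝ, 1 ≤ c → c • x ∈ U) {h ε C C' ρ R : ℝ} (hh : 0 < h) (hε : 0 < ε)
    (hC : C * (2 * ε) ≤ 1) (hC' : 0 < C')
    (hρ : 0 < ρ) {W : Euc d → Euc d} (hW : ContDiff ℝ 2 W) {q : Euc d → ℂ} (hq : Measurable q)
    {M : ℝ} (hM : ∀ x, ‖q x‖ ≤ M) {σ w : Euc d → ℂ} (hσ : IsTest (Punct d) σ)
    (hσμ : ∀ x ∈ annulus d ρ R, σ x = ((‖x‖ ^ 2 * dilWeight x : ℝ) : ℂ))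
    (hσH : ∀ p, IsTest U p → H1norm h U (fun x => σ x * p x) ^ 2 ≤ C' * energy h p p)
    (hrem : ∀ p, ∀ x ∈ annulus d ρ R,
      ‖weakRemainder h ε W q w p x‖ ≤ C * h ^ 2 * ‖w x‖ ^ 2 + energyDensity h p p x / 8)
    (hw : IsTest (annulus d ρ R) w) (hwU : IsTest U w) :
    h ^ 2 / (2 * ε) * pairing w w ≤ C' * Hneg1norm h U (conjOpEps h ε W q w) ^ 2 := by
  set N := Hneg1norm h U (conjOpEps h ε W q w)
  have hv := conjOpEps_memLp h ε hW hq hM (hwU.mono hU)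
  refine le_of_forall_pos_le_add fun δ hδ => ?_
  set η := δ / (1 + h + 1 / (4 * C')) with hη_def
  have hη : 0 < η := by positivity
  have hηδ : (1 + h) * η + η / (4 * C') = δ := by
    rw [hη_def]
    field_simp
  obtain ⟨p, hp, hpe⟩ := exists_test_energy_le hU hUs hh hε hρ hW hq hM hσ hσμ hrem hw hwU hη
  have hE := energy_self_nonneg h p
  have hc0 : 0 < C' * energy h p p + η := by positivity
  have hc := Real.sqrt_pos.2 hc0
  have hσp : IsTest U fun x => σ x * p x := hp.mul_left hU fun x _ => hσ.1.contDiffAt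
  have hle := norm_integral_le_Hneg1norm h U hv hσp hc
    (Real.le_sqrt_of_sq_le (by linarith [hσH p hp]))
  have hy : N * √(C' * energy h p p + η) ≤
      C' * N ^ 2 + (C' * energy h p p + η) / (4 * C') := by
    have e : C' * N ^ 2 + √(C' * energy h p p + η) ^ 2 / (4 * C') -
        N * √(C' * energy h p p + η) =
        (2 * C' * N - √(C' * energy h p p + η)) ^ 2 / (4 * C') := by
      field_simp
      ring
    have e' : 0 ≤ (2 * C' * N - √(C' * energy h p p + η)) ^ 2 / (4 * C') := by positivity
    rw [Real.sq_sqrt hc0.le] at e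
    linarith
  have hs : (C' * energy h p p + η) / (4 * C') = energy h p p / 4 + η / (4 * C') := by
    field_simp
  have hh2 : h ^ 2 / (2 * ε) * pairing w w ≤ (h ^ 2 / ε - C * h ^ 2) * pairing w w := by
    refine mul_le_mul_of_nonneg_right ?_ (pairing_self_nonneg w)
    have e1 : C * h ^ 2 ≤ h ^ 2 / (2 * ε) := by
      rw [le_div_iff₀ (by positivity)]
      nlinarith [sq_nonneg h]
    have e2 : h ^ 2 / ε = 2 * (h ^ 2 / (2 * ε)) := by field_simp
    linarith
  linarith

lemma sq_L2normOn_le {Ω : Set (Euc d)} {ρ R : ℝ} (hρ : 0 < ρ) (hΩ : Ω ⊆ annulus d ρ R)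
    {w : Euc d → ℂ} (hw : IsTest Ω w) :
    L2normOn Ω w ^ 2 ≤ Real.exp (d * (|Real.log ρ| + |Real.log R|)) * pairing w w := by
  have hw' : IsTest (Punct d) w := hw.mono (hΩ.trans (annulus_subset_punct hρ.le))
  have i₁ : Integrable fun x => ‖w x‖ ^ 2 :=
    hw'.integrable (hw'.1.continuous.norm.pow 2).continuousOn
      fun x hx => by simp [image_eq_zero_of_notMem_tsupport hx]
  have i₂ := hw'.integrable_norm_sq
  rw [L2normOn, Real.sq_sqrt (integral_nonneg fun x => sq_nonneg _), pairing]
  simp only [re_mul_conj_self]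
  refine (setIntegral_le_integral i₁ (Filter.Eventually.of_forall fun x => sq_nonneg _)).trans ?_
  rw [← integral_const_mul]
  refine integral_mono i₁ (i₂.const_mul _) fun x => ?_
  by_cases hx : x ∈ tsupport w
  · have hT := le_trans (le_abs_self _) (abs_carlWeight_le hρ (hΩ (hw.2.2 hx)))
    have h1 : 1 ≤ Real.exp (d * (|Real.log ρ| + |Real.log R|)) * dilWeight x := by
      rw [dilWeight, ← Real.exp_add]
      refine Real.one_le_exp ?_
      have := mul_le_mul_of_nonneg_left hT (Nat.cast_nonneg (α := ℝ) d)
      linarith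
    have := mul_le_mul_of_nonneg_right h1 (sq_nonneg ‖w x‖)
    simp only
    linarith
  · simp [image_eq_zero_of_notMem_tsupport hx]

lemma exists_carleman_estimate [Nontrivial (Euc d)] {U Ω : Set (Euc d)} (hU : U ⊆ Punct d)
    (hUs : ∀ x ∈ U, ∀ c : ℝ, 1 ≤ c → c • x ∈ U) (hΩU : Ω ⊆ U) {ρ R : ℝ} (hρ : 0 < ρ) (hR : 0 < R)
    (hΩ : Ω ⊆ annulus d ρ R) {W : Euc d → Euc d} (hW : ContDiff ℝ 2 W) {q : Euc d → ℂ}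
    (hq : Measurable q) {M : ℝ} (hM : ∀ x, ‖q x‖ ≤ M) :
    ∃ ε₀ > (0 : ℝ), ∃ C > (0 : ℝ), ∀ ε ∈ Set.Ioc (0 : ℝ) ε₀, ∃ h₀ > (0 : ℝ),
      ∀ h ∈ Set.Ioc (0 : ℝ) h₀, ∀ w : Euc d → ℂ, IsTest Ω w →
        (h / Real.sqrt ε) * L2normOn Ω w ≤ C * Hneg1norm h U (conjOpEps h ε W q w) := by
  obtain ⟨C₁, hC₁, hrem⟩ := exists_weakRemainder_le (R := R) hρ hW hM
  obtain ⟨σ, hσ, hσμ⟩ := exists_cutoff (d := d) hρ hR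
  obtain ⟨C₂, hC₂, hσH⟩ := exists_H1norm_mul_sq_le hσ
  set K := Real.exp (d * (|Real.log ρ| + |Real.log R|))
  refine ⟨1 / (2 * C₁), by positivity, √(2 * C₂ * K), by positivity, fun ε hε => ?_⟩
  have hε0 := hε.1
  refine ⟨min 1 (min ε (ε ^ 2)), by positivity, fun h hh w hw => ?_⟩
  obtain ⟨hh0, hh1⟩ := hh
  rw [le_min_iff, le_min_iff] at hh1
  have hCε : C₁ * (2 * ε) ≤ 1 := by
    have := (le_div_iff₀ (by positivity)).1 hε.2
    linarith
  have h₁ := pairing_self_le_sq_Hneg1norm hU hUs hh0 hε0 hCε hC₂ hρ hW hq hM hσ hσμ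
    (hσH h hh0 hh1.1 U hU) (hrem ε h hε0 hh0 hh1.1 hh1.2.1 hh1.2.2 w) (hw.mono hΩ) (hw.mono hΩU)
  have h₂ := sq_L2normOn_le hρ hΩ hw
  refine le_of_sq_le_sq ?_ (mul_nonneg (Real.sqrt_nonneg _) (Hneg1norm_nonneg _ _ _))
  rw [mul_pow, mul_pow, div_pow, Real.sq_sqrt hε0.le, Real.sq_sqrt (by positivity)]
  calc h ^ 2 / ε * L2normOn Ω w ^ 2 ≤ h ^ 2 / ε * (K * pairing w w) := by gcongr
    _ = 2 * K * (h ^ 2 / (2 * ε) * pairing w w) := by field_simp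
    _ ≤ 2 * K * (C₂ * Hneg1norm h U (conjOpEps h ε W q w) ^ 2) := by gcongr
    _ = _ := by ring

end CarlemanEstimate

/-- Carleman estimate with convexified logarithmic weight (Proposition 2.1-type statement). -/
theorem stmt0 (n : ℕ) (hn : 2 ≤ n)
    (f : Euc (n + 1) → ℝ)
    (hf_smooth : ContDiffOn ℝ (⊤ : ℕ∞) (fun x => f (‖x‖⁻¹ • x)) {x : Euc (n + 1) | x ≠ 0})
    (hf_pos : ∀ x : Euc (n + 1), x ≠ 0 → 0 < f (‖x‖⁻¹ • x))
    (Ω : Set (Euc (n + 1))) (hΩopen : IsOpen Ω) (hΩbdd : Bornology.IsBounded Ω)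
    (hΩA : Ω ⊆ {x : Euc (n + 1) | x ≠ 0 ∧ f (‖x‖⁻¹ • x) ≤ ‖x‖})
    (hx0 : (0 : Euc (n + 1)) ∉ closure (convexHull ℝ Ω))
    (W : Euc (n + 1) → Euc (n + 1)) (hW : ContDiff ℝ 2 W)
    (q : Euc (n + 1) → ℂ) (hq_meas : Measurable q) (hq_bdd : ∃ M : ℝ, ∀ x, ‖q x‖ ≤ M) :
    ∃ ε₀ > (0 : ℝ), ∃ C > (0 : ℝ), ∀ ε ∈ Set.Ioc (0 : ℝ) ε₀, ∃ h₀ > (0 : ℝ),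
      ∀ h ∈ Set.Ioc (0 : ℝ) h₀, ∀ w : Euc (n + 1) → ℂ, IsTest Ω w →
        (h / Real.sqrt ε) * L2normOn Ω w ≤
          C * Hneg1norm h {x : Euc (n + 1) | x ≠ 0 ∧ f (‖x‖⁻¹ • x) < ‖x‖}
            (conjOpEps h ε W q w) := by
  obtain ⟨M, hM⟩ := hq_bdd
  have h0 : (0 : Euc (n + 1)) ∉ closure Ω := fun h =>
    hx0 (closure_mono (subset_convexHull ℝ Ω) h)
  obtain ⟨ρ, hρ, hball⟩ := Metric.nhds_basis_ball.mem_iff.1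
    (isClosed_closure.isOpen_compl.mem_nhds h0)
  obtain ⟨R, hR, hΩR⟩ := hΩbdd.subset_ball_lt 0 0
  refine exists_carleman_estimate (fun x hx => hx.1) (fun x hx c hc => ?_) (fun x hx => ?_)
    (half_pos hρ) hR (fun x hx => ⟨?_, by simpa using hΩR hx⟩) hW hq_meas hM
  · have hc0 : 0 < c := by linarith
    refine ⟨smul_ne_zero hc0.ne' hx.1, ?_⟩
    have hdir : ‖c • x‖⁻¹ • (c • x) = ‖x‖⁻¹ • x := by
      rw [norm_smul, Real.norm_of_nonneg hc0.le, smul_smul, mul_inv, mul_right_comm,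
        inv_mul_cancel₀ hc0.ne', one_mul]
    have hx' : 0 < ‖x‖ := norm_pos_iff.2 hx.1
    rw [hdir, norm_smul, Real.norm_of_nonneg hc0.le]
    exact hx.2.trans_le (le_mul_of_one_le_left hx'.le hc)
  · have hx' := (hΩA hx).1
    have hcont : Filter.Tendsto (fun c : ℝ => c • x) (nhdsWithin 1 (Set.Iio 1)) (nhds x) := by
      have : Continuous fun c : ℝ => c • x := by fun_prop
      simpa using (this.tendsto 1).mono_left nhdsWithin_le_nhds
    obtain ⟨c, hcΩ, hc1, hc0⟩ := ((hcont.eventually (hΩopen.mem_nhds hx)).and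
      (eventually_mem_nhdsWithin.and
        ((eventually_gt_nhds (zero_lt_one' ℝ)).filter_mono nhdsWithin_le_nhds))).exists
    have hle := (hΩA hcΩ).2
    rw [norm_smul, Real.norm_of_nonneg hc0.le, smul_smul, mul_inv, mul_right_comm,
      inv_mul_cancel₀ hc0.ne', one_mul] at hle
    exact ⟨hx', hle.trans_lt (mul_lt_of_lt_one_left (norm_pos_iff.2 hx') hc1)⟩
  · by_contra hlt
    have hlt' : ‖x‖ < ρ := by linarith
    exact hball (by simpa using hlt') (subset_closure hx)
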